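/- Let Δ = (T, 𝒮, ℬ) be a strong triangle blocking arrangement with vertices x₁, x₂, x₃ of T. Suppose there are vertices a₁, b₁ ∈ x₁x₂ and a₂, b₂ ∈ x₂x₃ such that x₁, b₁, a₁, x₂ appear in this order on the edge x₁x₂, x₃, a₂, b₂, x₂ appear in this order on the edge x₂x₃, and a₁a₂, b₁b₂ are proper initial segments intersecting at a point c. Then the subsegment a₁c of a₁a₂ and the subsegment b₂c of b₁b₂ are minimal, and there is a blocking segment passing through both x₂ and c (i.e., β(x₂) passes through c). -/

import Mathlib

open Set

noncomputable section

/-- Points of the real plane. -/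
abbrev Pt := ℝ × ℝ

/-- The boundary of the triangle with vertices `x1`, `x2`, `x3`:
the union of its three edges. -/
def triBdry (x1 x2 x3 : Pt) : Set Pt :=
  segment ℝ x1 x2 ∪ segment ℝ x2 x3 ∪ segment ℝ x3 x1

/-- The three edges of the triangle with vertices `x1`, `x2`, `x3`. -/
def triEdges (x1 x2 x3 : Pt) : Set (Set Pt) :=
  {segment ℝ x1 x2, segment ℝ x2 x3, segment ℝ x3 x1}

/-- A triangle blocking arrangement: a nondegenerate triangle `x1 x2 x3` together with two
finite collections `S` (proper initial segments) and `B` (blocking segments) of closed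
segments with endpoints on the boundary of the triangle and no interior point on the
boundary, satisfying the intersection conditions (i) and (ii). `S ∪ triEdges x1 x2 x3`
is the collection of initial segments `𝒮̄`. -/
structure TBA where
  x1 : Pt
  x2 : Pt
  x3 : Pt
  S : Set (Set Pt)
  B : Set (Set Pt)
  indep : AffineIndependent ℝ ![x1, x2, x3]
  finS : S.Finite
  finB : B.Finite
  seg_wf : ∀ s ∈ S ∪ B, ∃ a b : Pt, a ≠ b ∧ s = segment ℝ a b ∧
    a ∈ triBdry x1 x2 x3 ∧ b ∈ triBdry x1 x2 x3 ∧
    ∀ p ∈ openSegment ℝ a b, p ∉ triBdry x1 x2 x3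
  /- (i) no three initial segments are concurrent … -/
  no_three_concurrent : ∀ s₁ ∈ S ∪ triEdges x1 x2 x3, ∀ s₂ ∈ S ∪ triEdges x1 x2 x3,
    ∀ s₃ ∈ S ∪ triEdges x1 x2 x3, s₁ ≠ s₂ → s₁ ≠ s₃ → s₂ ≠ s₃ →
    ¬ ∃ p : Pt, p ∈ s₁ ∧ p ∈ s₂ ∧ p ∈ s₃
  /- … and through every intersection point of two initial segments, not both edges,
  there is a unique blocking segment … -/
  block_exists : ∀ s₁ ∈ S ∪ triEdges x1 x2 x3, ∀ s₂ ∈ S ∪ triEdges x1 x2 x3, s₁ ≠ s₂ →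
    ¬ (s₁ ∈ triEdges x1 x2 x3 ∧ s₂ ∈ triEdges x1 x2 x3) →
    ∀ p : Pt, p ∈ s₁ → p ∈ s₂ → ∃! b, b ∈ B ∧ p ∈ b
  /- … while through an intersection point of two edges there is at most one
  blocking segment. -/
  block_unique : ∀ s₁ ∈ S ∪ triEdges x1 x2 x3, ∀ s₂ ∈ S ∪ triEdges x1 x2 x3, s₁ ≠ s₂ →
    ∀ p : Pt, p ∈ s₁ → p ∈ s₂ → ∀ b₁ ∈ B, ∀ b₂ ∈ B, p ∈ b₁ → p ∈ b₂ → b₁ = b₂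
  /- (ii) through every intersection point of an initial segment and a blocking segment
  there is a unique second initial segment. -/
  second_segment : ∀ s ∈ S ∪ triEdges x1 x2 x3, ∀ b ∈ B, ∀ p : Pt, p ∈ s → p ∈ b →
    ∃! s', s' ∈ S ∪ triEdges x1 x2 x3 ∧ s' ≠ s ∧ p ∈ s'

namespace TBA

variable (Δ : TBA)

/-- The collection `𝒮̄` of initial segments. -/
def Sbar : Set (Set Pt) := Δ.S ∪ triEdges Δ.x1 Δ.x2 Δ.x3

/-- The (closed) triangle `T`. -/
def tri : Set Pt := convexHull ℝ {Δ.x1, Δ.x2, Δ.x3}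

/-- The boundary `∂T`. -/
def bdry : Set Pt := triBdry Δ.x1 Δ.x2 Δ.x3

/-- A vertex of the arrangement: an intersection point of two initial segments. -/
def IsVertex (p : Pt) : Prop :=
  ∃ s₁ ∈ Δ.Sbar, ∃ s₂ ∈ Δ.Sbar, s₁ ≠ s₂ ∧ p ∈ s₁ ∧ p ∈ s₂

/-- The segment `xy` is minimal if no vertex of the arrangement lies in its interior. -/
def MinimalSeg (x y : Pt) : Prop :=
  ∀ p ∈ openSegment ℝ x y, ¬ Δ.IsVertex p

/-- An `𝒮̄`-region: the closure of a connected component of `T \ ⋃ L` for some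
subset `L` of `𝒮̄`. -/
def IsRegion (R : Set Pt) : Prop :=
  ∃ L ⊆ Δ.Sbar, ∃ p ∈ Δ.tri \ ⋃₀ L,
    R = closure (connectedComponentIn (Δ.tri \ ⋃₀ L) p)

/-- A minimal `𝒮̄`-region: the closure of a connected component of `T \ ⋃ 𝒮̄`. -/
def IsMinRegion (R : Set Pt) : Prop :=
  ∃ p ∈ Δ.tri \ ⋃₀ Δ.Sbar,
    R = closure (connectedComponentIn (Δ.tri \ ⋃₀ Δ.Sbar) p)

/-- The set `s` contains an edge of the region `R`: it contains a nondegenerate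
segment lying on the boundary of `R`. -/
def ContainsEdgeOf (_Δ : TBA) (s R : Set Pt) : Prop :=
  ∃ q₁ q₂ : Pt, q₁ ≠ q₂ ∧ segment ℝ q₁ q₂ ⊆ s ∩ frontier R

/-- A vertex of the region `R`: a point of `R` that is the intersection of two initial
segments, each containing an edge of `R`. -/
def IsRegionVertex (R : Set Pt) (p : Pt) : Prop :=
  p ∈ R ∧ ∃ s₁ ∈ Δ.Sbar, ∃ s₂ ∈ Δ.Sbar, s₁ ≠ s₂ ∧ p ∈ s₁ ∧ p ∈ s₂ ∧
    Δ.ContainsEdgeOf s₁ R ∧ Δ.ContainsEdgeOf s₂ R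

/-- A vertex `p` is internally blocked in the region `R` if the blocking segment
through `p` exists and meets the interior of `R`.  (Externally blocked means not
internally blocked.) -/
def InternallyBlocked (R : Set Pt) (p : Pt) : Prop :=
  ∃ b ∈ Δ.B, p ∈ b ∧ (b ∩ interior R).Nonempty

/-- Two consecutive vertices of a region `R`: distinct vertices joined by an edge
lying on the boundary of `R`. -/
def Consec (R : Set Pt) (u v : Pt) : Prop :=
  u ≠ v ∧ Δ.IsRegionVertex R u ∧ Δ.IsRegionVertex R v ∧ segment ℝ u v ⊆ frontier R

/-- Condition (A): the arrangement is strong when for every minimal `𝒮̄`-region `R` and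
consecutive vertices `v₁, v₂, v₃, v₄, v₅` in this order along `∂R`, if the line
`l(v₁v₂)` and the blocking segment `β(v₃)` intersect inside `T`, and `β(v₃)` meets the
interior of `R`, then `l(v₁v₂)`, `β(v₃)` and `l(v₄v₅)` are concurrent. -/
def Strong : Prop :=
  ∀ R : Set Pt, Δ.IsMinRegion R →
  ∀ v₁ v₂ v₃ v₄ v₅ : Pt, List.Pairwise (· ≠ ·) [v₁, v₂, v₃, v₄, v₅] →
    Δ.Consec R v₁ v₂ → Δ.Consec R v₂ v₃ → Δ.Consec R v₃ v₄ → Δ.Consec R v₄ v₅ →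
    ∀ b ∈ Δ.B, v₃ ∈ b → (b ∩ interior R).Nonempty →
    (∃ q ∈ Δ.tri, q ∈ affineSpan ℝ ({v₁, v₂} : Set Pt) ∧ q ∈ b) →
    ∃ q : Pt, q ∈ b ∧ q ∈ affineSpan ℝ ({v₁, v₂} : Set Pt) ∧
      q ∈ affineSpan ℝ ({v₄, v₅} : Set Pt)

end TBA

/-! ### Affine functionals along segments -/

theorem openSegment_affine {x y z : Pt} (hz : z ∈ openSegment ℝ x y) :
    ∃ s t : ℝ, 0 < s ∧ 0 < t ∧ s + t = 1 ∧ ∀ φ : Pt →ᵃ[ℝ] ℝ, φ z = s * φ x + t * φ y := by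
  obtain ⟨s, t, hs, ht, hst, rfl⟩ := hz
  exact ⟨s, t, hs, ht, hst, fun φ => by
    simpa [smul_eq_mul] using Convex.combo_affine_apply (f := φ) hst⟩

theorem exists_zero_of_mul_neg {φ : Pt →ᵃ[ℝ] ℝ} {x y : Pt} (h : φ x * φ y < 0) :
    ∃ z ∈ openSegment ℝ x y, φ z = 0 := by
  have hd : φ y - φ x ≠ 0 := fun h0 => by
    rw [sub_eq_zero.mp h0] at h
    exact absurd h (not_lt.mpr (mul_self_nonneg _))
  have hst : φ y / (φ y - φ x) + -φ x / (φ y - φ x) = 1 := by field_simp; ring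
  have hpos : 0 < (φ y - φ x) ^ 2 := by positivity
  have e1 : φ y / (φ y - φ x) = φ y * (φ y - φ x) / (φ y - φ x) ^ 2 := by field_simp
  have e2 : -φ x / (φ y - φ x) = -φ x * (φ y - φ x) / (φ y - φ x) ^ 2 := by field_simp
  refine ⟨_, ⟨φ y / (φ y - φ x), -φ x / (φ y - φ x), ?_, ?_, hst, rfl⟩, ?_⟩
  · rw [e1]; exact div_pos (by nlinarith [sq_nonneg (φ y)]) hpos
  · rw [e2]; exact div_pos (by nlinarith [sq_nonneg (φ x)]) hpos
  · rw [Convex.combo_affine_apply hst]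
    simp only [smul_eq_mul]; field_simp; ring

theorem mul_neg_of_zero_between {φ : Pt →ᵃ[ℝ] ℝ} {x y z : Pt} (hz : z ∈ openSegment ℝ x y)
    (h0 : φ z = 0) (hx : φ x ≠ 0) : φ x * φ y < 0 := by
  obtain ⟨s, t, hs, ht, -, h⟩ := openSegment_affine hz
  have h1 := h φ
  rw [h0] at h1
  have hx2 : 0 < φ x ^ 2 := by positivity
  have : t * (φ x * φ y) = -(s * φ x ^ 2) := by linear_combination -φ x * h1
  by_contra hc
  have h2 : 0 ≤ t * (φ x * φ y) := mul_nonneg ht.le (not_lt.mp hc)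
  have h3 : 0 < s * φ x ^ 2 := mul_pos hs hx2
  linarith

theorem mul_pos_of_zero_left {φ : Pt →ᵃ[ℝ] ℝ} {x y z : Pt} (hz : z ∈ openSegment ℝ x y)
    (h0 : φ x = 0) (hy : φ y ≠ 0) : 0 < φ z * φ y := by
  obtain ⟨s, t, hs, ht, -, h⟩ := openSegment_affine hz
  have hy2 : 0 < φ y ^ 2 := by positivity
  have : φ z * φ y = t * φ y ^ 2 := by rw [h φ, h0]; ring
  rw [this]; exact mul_pos ht hy2

theorem mul_neg_extend {φ : Pt →ᵃ[ℝ] ℝ} {x y z : Pt} (hz : z ∈ openSegment ℝ x y)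
    (h : φ x * φ z < 0) : φ x * φ y < 0 := by
  obtain ⟨s, t, hs, ht, -, h'⟩ := openSegment_affine hz
  rw [h' φ] at h
  by_contra hc
  have h2 : 0 ≤ t * (φ x * φ y) := mul_nonneg ht.le (not_lt.mp hc)
  have h3 : 0 ≤ s * φ x ^ 2 := mul_nonneg hs.le (sq_nonneg _)
  nlinarith

theorem ne_of_mem_openSegment {x y z : Pt} (hxy : x ≠ y) (hz : z ∈ openSegment ℝ x y) :
    z ≠ x := by
  rintro rfl
  exact hxy (left_mem_openSegment_iff.mp hz)

theorem mem_openSegment_swap {x y z : Pt} (hz : z ∈ openSegment ℝ x y) :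
    z ∈ openSegment ℝ y x := by rwa [openSegment_symm]

theorem zero_of_zero {φ : Pt →ᵃ[ℝ] ℝ} {x y z : Pt} (hz : z ∈ openSegment ℝ x y)
    (hx : φ x = 0) (hy : φ y = 0) : φ z = 0 := by
  obtain ⟨s, t, -, -, -, h⟩ := openSegment_affine hz
  rw [h φ, hx, hy]; ring

theorem mul_neg_of_mul_pos_of_mul_neg {a b c : ℝ} (h1 : 0 < a * b) (h2 : a * c < 0) : b * c < 0 := by
  rcases lt_trichotomy a 0 with h | h | h
  · have hb : b < 0 := by by_contra hb; nlinarith [not_lt.mp hb]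
    have hc : 0 < c := by by_contra hc; nlinarith [not_lt.mp hc]
    exact mul_neg_of_neg_of_pos hb hc
  · simp [h] at h1
  · have hb : 0 < b := by by_contra hb; nlinarith [not_lt.mp hb]
    have hc : c < 0 := by by_contra hc; nlinarith [not_lt.mp hc]
    exact _root_.mul_neg_of_pos_of_neg hb hc

/-- A finite system of lines `f i` and blocking lines `h k`, given by affine functionals, in a
convex region `T` cut out by the lines satisfying `edge`. -/
structure LineSystem (ι κ : Type) where
  T : Set Pt
  f : ι → Pt →ᵃ[ℝ] ℝ
  h : κ → Pt →ᵃ[ℝ] ℝ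
  edge : ι → Prop
  mem_T : ∀ p, p ∈ T ↔ ∀ e, edge e → 0 ≤ f e p
  escape : ∀ d : Pt, d ≠ 0 → ∃ e, edge e ∧ (f e).linear d < 0
  coll : ∀ i x y z, f i x = 0 → f i y = 0 → f i z = 0 → x ≠ y →
    ∃ t : ℝ, z = AffineMap.lineMap x y t
  two : ∀ i, ∃ x ∈ T, ∃ y ∈ T, x ≠ y ∧ f i x = 0 ∧ f i y = 0
  inj : ∀ i j x y, x ∈ T → y ∈ T → x ≠ y → f i x = 0 → f i y = 0 → f j x = 0 → f j y = 0 →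
    i = j
  no_three : ∀ i j k p, i ≠ j → i ≠ k → j ≠ k → p ∈ T → f i p = 0 → f j p = 0 → f k p ≠ 0
  block : ∀ i j p, i ≠ j → ¬ (edge i ∧ edge j) → p ∈ T → f i p = 0 → f j p = 0 →
    ∃ k, h k p = 0
  block_sep : ∀ i k p q, p ∈ T → q ∈ T → p ≠ q → f i p = 0 → f i q = 0 → h k p = 0 → h k q ≠ 0
  second : ∀ i k p, p ∈ T → f i p = 0 → h k p = 0 → ∃ j, j ≠ i ∧ f j p = 0

namespace LineSystem

variable {ι κ : Type} (L : LineSystem ι κ)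

/-- No line separates `x` from `y`. -/
def Unsep (x y : Pt) : Prop := ∀ k, 0 ≤ L.f k x * L.f k y

/-- The form in which condition (A) is used: `v₂, v₃, v₄` are consecutive vertices of a cell,
and the blocking line through `v₃` separates `v₂` from `v₄`. -/
def StrongStep : Prop := ∀ (k : κ) (i₁₂ i₂₃ i₃₄ i₄₅ : ι) (v₂ v₃ v₄ g : Pt),
  v₂ ∈ L.T → v₃ ∈ L.T → v₄ ∈ L.T → g ∈ L.T →
  L.f i₁₂ v₂ = 0 → L.f i₂₃ v₂ = 0 → L.f i₂₃ v₃ = 0 → L.f i₃₄ v₃ = 0 → L.f i₃₄ v₄ = 0 →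
  L.f i₄₅ v₄ = 0 → i₁₂ ≠ i₂₃ → i₂₃ ≠ i₃₄ → i₃₄ ≠ i₄₅ → v₂ ≠ v₃ → v₄ ≠ v₃ →
  L.Unsep v₃ v₂ → L.Unsep v₃ v₄ → L.h k v₃ = 0 → L.h k v₂ * L.h k v₄ < 0 →
  L.h k g = 0 → L.f i₁₂ g = 0 → L.f i₄₅ g = 0

variable {L}

theorem Unsep.symm {x y : Pt} (h : L.Unsep x y) : L.Unsep y x := fun k => by
  rw [mul_comm]; exact h k

theorem mem_of_openSegment {x y z : Pt} (hx : x ∈ L.T) (hy : y ∈ L.T)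
    (hz : z ∈ openSegment ℝ x y) : z ∈ L.T := by
  obtain ⟨s, t, hs, ht, -, h⟩ := openSegment_affine hz
  rw [L.mem_T] at *
  intro e he
  rw [h]
  exact add_nonneg (mul_nonneg hs.le (hx e he)) (mul_nonneg ht.le (hy e he))

theorem not_edge_of_mul_neg {x y : Pt} {i : ι} (hx : x ∈ L.T) (hy : y ∈ L.T)
    (h : L.f i x * L.f i y < 0) : ¬ L.edge i := fun he =>
  absurd h (not_lt.mpr (mul_nonneg ((L.mem_T x).mp hx i he) ((L.mem_T y).mp hy i he)))

theorem eq_of_zero {i j : ι} {x y : Pt} (hij : i ≠ j) (hx : x ∈ L.T) (hy : y ∈ L.T)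
    (h1 : L.f i x = 0) (h2 : L.f i y = 0) (h3 : L.f j x = 0) (h4 : L.f j y = 0) : x = y := by
  by_contra h
  exact hij (L.inj i j x y hx hy h h1 h2 h3 h4)

theorem eq_or_eq {i j k : ι} {p : Pt} (hij : i ≠ j) (hp : p ∈ L.T) (h1 : L.f i p = 0)
    (h2 : L.f j p = 0) (h3 : L.f k p = 0) : k = i ∨ k = j := by
  by_contra hc
  push Not at hc
  exact L.no_three i j k p hij (Ne.symm hc.1) (Ne.symm hc.2) hp h1 h2 h3

/-- A blocking line does not cross an edge of a cell. -/
theorem block_unsep {i : ι} {x y : Pt} (hx : x ∈ L.T) (hy : y ∈ L.T) (h1 : L.f i x = 0)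
    (h2 : L.f i y = 0) (h : L.Unsep x y) (k : κ) : 0 ≤ L.h k x * L.h k y := by
  by_contra hc
  push Not at hc
  obtain ⟨z, hz, hz0⟩ := exists_zero_of_mul_neg hc
  have hxy : x ≠ y := by
    rintro rfl
    nlinarith [sq_nonneg (L.h k x)]
  have hzT := mem_of_openSegment hx hy hz
  obtain ⟨j, hji, hj⟩ := L.second i k z hzT (zero_of_zero hz h1 h2) hz0
  have hjx : L.f j x ≠ 0 := fun h0 => by
    have h0' : L.f j y = 0 := by
      obtain ⟨s, t, -, ht, -, h'⟩ := openSegment_affine hz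
      have := h' (L.f j)
      rw [hj, h0] at this
      have : t * L.f j y = 0 := by linarith
      exact (mul_eq_zero.mp this).resolve_left ht.ne'
    exact hji (L.inj j i x y hx hy hxy h0 h0' h1 h2)
  exact absurd (h j) (not_le.mpr (mul_neg_of_zero_between hz hj hjx))

/-- Two points on a line through `p`, on the same side of `p`, are not separated by a
functional vanishing at `p`. -/
theorem mul_pos_same_side {m : ι} {p y y' : Pt} (hpy : p ≠ y) (hp : L.f m p = 0)
    (hy : L.f m y = 0) (hy' : L.f m y' = 0) {φ ψ : Pt →ᵃ[ℝ] ℝ} (hφp : φ p = 0)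
    (hφ : 0 < φ y * φ y') (hψp : ψ p = 0) (hψ : ψ y ≠ 0) : 0 < ψ y * ψ y' := by
  obtain ⟨t, rfl⟩ := L.coll m p y y' hp hy hy' hpy
  have key : ∀ χ : Pt →ᵃ[ℝ] ℝ, χ p = 0 → χ (AffineMap.lineMap p y t) = t * χ y := by
    intro χ h
    rw [AffineMap.apply_lineMap, h, AffineMap.lineMap_apply_ring']
    ring
  rw [key φ hφp] at hφ
  rw [key ψ hψp]
  have ht : 0 < t := by
    by_contra hc
    nlinarith [mul_nonneg (neg_nonneg.mpr (not_lt.mp hc)) (sq_nonneg (φ y))]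
  have : 0 < ψ y ^ 2 := by positivity
  nlinarith [mul_pos ht this]

/-- Two triangular cells do not share an edge. -/
theorem false_of_adjacent {i m n n' : ι} {p x x' y y' : Pt} (him : i ≠ m)
    (hne : ¬ (L.edge i ∧ L.edge m)) (hp : p ∈ L.T) (hx : x ∈ L.T) (hx' : x' ∈ L.T)
    (hy : y ∈ L.T) (hy' : y' ∈ L.T) (hpx : p ≠ x) (hpy : p ≠ y)
    (hpi : L.f i p = 0) (hpm : L.f m p = 0) (hxi : L.f i x = 0)
    (hym : L.f m y = 0) (hym' : L.f m y' = 0)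
    (hb : p ∈ openSegment ℝ x x') (hs : 0 < L.f i y * L.f i y')
    (hxn : L.f n x = 0) (hyn : L.f n y = 0) (hxn' : L.f n' x' = 0) (hyn' : L.f n' y' = 0)
    (hE : L.Unsep x y) (hE' : L.Unsep x' y') : False := by
  obtain ⟨k, hk⟩ := L.block i m p him hne hp hpi hpm
  have hkx := L.block_sep i k p x hp hx hpx hpi hxi hk
  have hky := L.block_sep m k p y hp hy hpy hpm hym hk
  have h1 := mul_neg_of_zero_between hb hk hkx
  have h2 := mul_pos_same_side hpy hpm hym hym' hpi hs hk hky
  have h3 := block_unsep hx hy hxn hyn hE k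
  have h4 := block_unsep hx' hy' hxn' hyn' hE' k
  have h5 : 0 < L.h k x * L.h k y := lt_of_le_of_ne h3 (mul_ne_zero hkx hky).symm
  have h6 := mul_neg_of_mul_pos_of_mul_neg h5 h1
  have h7 := mul_neg_of_mul_pos_of_mul_neg h2 h6
  rw [mul_comm] at h7
  exact absurd h4 (not_le.mpr h7)

/-- Moving from `v` along the line `i`, there is a first further line that is met. -/
theorem exists_ray [Finite ι] {i : ι} {v d : Pt} (hv : v ∈ L.T) (hi : L.f i v = 0) (hd : d ≠ 0)
    (hid : (L.f i).linear d = 0) (hedge : ∀ e, L.edge e → L.f e v = 0 → 0 ≤ (L.f e).linear d) :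
    ∃ t : ℝ, 0 < t ∧ v + t • d ∈ L.T ∧ L.f i (v + t • d) = 0 ∧ L.Unsep v (v + t • d) ∧
      ∃ j, j ≠ i ∧ L.f j (v + t • d) = 0 := by
  have key : ∀ k (t : ℝ), L.f k (v + t • d) = L.f k v + t * (L.f k).linear d := by
    intro k t
    have := (L.f k).map_vadd v (t • d)
    simp only [vadd_eq_add, map_smul, smul_eq_mul] at this
    rw [add_comm v, this, add_comm]
  obtain ⟨e, he, hed⟩ := L.escape d hd
  have hev : 0 < L.f e v := by
    refine lt_of_le_of_ne ((L.mem_T v).mp hv e he) fun h0 => ?_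
    exact absurd (hedge e he h0.symm) (not_le.mpr hed)
  let S : Set ι := {k | L.f k v * (L.f k).linear d < 0}
  have hS : S.Nonempty := ⟨e, mul_neg_of_pos_of_neg hev hed⟩
  obtain ⟨j, hjS, hj⟩ := Set.exists_min_image S (fun k => -L.f k v / (L.f k).linear d)
    (Set.toFinite S) hS
  have hjS' : L.f j v * (L.f j).linear d < 0 := hjS
  have hj0 : (L.f j).linear d ≠ 0 := fun h0 => by simp [h0] at hjS'
  set t := -L.f j v / (L.f j).linear d with ht
  have htpos : 0 < t := by
    have : t = -(L.f j v * (L.f j).linear d) / ((L.f j).linear d) ^ 2 := by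
      rw [ht]; field_simp
    rw [this]
    exact div_pos (by linarith) (by positivity)
  have hle : ∀ k, L.f k v * (L.f k).linear d < 0 →
      0 ≤ L.f k v * (L.f k v + t * (L.f k).linear d) := by
    intro k hk
    have h1 : t ≤ -L.f k v / (L.f k).linear d := hj k hk
    have hk0 : (L.f k).linear d ≠ 0 := fun h0 => by simp [h0] at hk
    have h2 : -L.f k v / (L.f k).linear d * (L.f k).linear d = -L.f k v := by field_simp
    have h3 : L.f k v * (L.f k v + t * (L.f k).linear d) =
        (-L.f k v / (L.f k).linear d - t) * -(L.f k v * (L.f k).linear d) := by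
      linear_combination L.f k v * h2
    rw [h3]
    exact mul_nonneg (sub_nonneg.mpr h1) (neg_nonneg.mpr hk.le)
  have huns : L.Unsep v (v + t • d) := by
    intro k
    rw [key]
    by_cases hk : L.f k v * (L.f k).linear d < 0
    · exact hle k hk
    · nlinarith [mul_nonneg htpos.le (not_lt.mp hk), mul_self_nonneg (L.f k v)]
  refine ⟨t, htpos, ?_, by rw [key, hi, hid]; ring, huns, j, ?_, ?_⟩
  · rw [L.mem_T]
    intro e' he'
    have h0 := (L.mem_T v).mp hv e' he'
    rcases h0.eq_or_lt with h0 | h0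
    · rw [key, ← h0]
      have := mul_nonneg htpos.le (hedge e' he' h0.symm)
      linarith
    · have := huns e'
      exact nonneg_of_mul_nonneg_right this h0
  · rintro rfl
    exact hj0 hid
  · rw [key, ht]; field_simp; ring

theorem exists_next [Finite ι] {i : ι} {p q : Pt} (hp : p ∈ L.T) (hpi : L.f i p = 0)
    (hqi : L.f i q = 0) (hpq : p ≠ q) (hedge : ∀ e, L.edge e → L.f e p ≠ 0) :
    ∃ w ∈ L.T, L.f i w = 0 ∧ p ∈ openSegment ℝ q w ∧ L.Unsep p w ∧ ∃ j, j ≠ i ∧ L.f j w = 0 := by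
  have hlin : (L.f i).linear (p - q) = 0 := by
    have := (L.f i).linearMap_vsub p q
    simp only [vsub_eq_sub] at this
    rw [this, hpi, hqi, sub_zero]
  obtain ⟨t, ht, hT, h0, hE, hj⟩ := exists_ray hp hpi (sub_ne_zero.mpr hpq) hlin
    fun e he h0 => absurd h0 (hedge e he)
  refine ⟨_, hT, h0, ⟨t / (1 + t), 1 / (1 + t), by positivity, by positivity, by field_simp; ring,
    ?_⟩, hE, hj⟩
  have h1 : t / (1 + t) + 1 / (1 + t) * (-t) = 0 := by field_simp; ring
  have h2 : 1 / (1 + t) * (1 + t) = 1 := by field_simp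
  have : (t / (1 + t)) • q + (1 / (1 + t)) • (p + t • (p - q)) =
      (t / (1 + t) + 1 / (1 + t) * (-t)) • q + (1 / (1 + t) * (1 + t)) • p := by module
  rw [this, h1, h2]; simp

theorem mem_openSegment_trans_false {x y z : Pt} {φ : Pt →ᵃ[ℝ] ℝ} (h1 : x ∈ openSegment ℝ y z)
    (h2 : y ∈ openSegment ℝ x z) (hx : φ x = 0) (hy : φ y ≠ 0) : False := by
  have h3 := mul_neg_of_zero_between h1 hx hy
  have hz : φ z ≠ 0 := fun h0 => by simp [h0] at h3
  exact absurd (mul_pos_of_zero_left h2 hx hz) (not_lt.mpr h3.le)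

/-- The side `p q` of a quadrilateral cell `p q v u` with opposite side on `l`, next to a
triangular cell `p q r`: the line `s` meets `l` beyond `p`, at the next vertex. -/
theorem exists_meet [Finite ι] (hS : L.StrongStep) {s k₁ k₂ l : ι} {p q r u v : Pt}
    (hp : p ∈ L.T) (hq : q ∈ L.T) (hr : r ∈ L.T) (hu : u ∈ L.T) (hv : v ∈ L.T)
    (hs1 : s ≠ k₁) (hs2 : s ≠ k₂) (h12 : k₁ ≠ k₂) (h2l : k₂ ≠ l)
    (hes : ¬ L.edge s) (he1 : ¬ L.edge k₁) (hpq : p ≠ q) (hpr : p ≠ r)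
    (sp : L.f s p = 0) (sq : L.f s q = 0) (k1p : L.f k₁ p = 0) (k1r : L.f k₁ r = 0)
    (k1u : L.f k₁ u = 0) (k2q : L.f k₂ q = 0) (k2r : L.f k₂ r = 0) (k2v : L.f k₂ v = 0)
    (lu : L.f l u = 0) (lv : L.f l v = 0) (hpo : p ∈ openSegment ℝ r u)
    (Epr : L.Unsep p r) (Erq : L.Unsep r q) (Eqv : L.Unsep q v) (Euv : L.Unsep u v) :
    ∃ w ∈ L.T, L.f s w = 0 ∧ L.f l w = 0 ∧ p ∈ openSegment ℝ q w ∧ L.Unsep p w := by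
  obtain ⟨k, hk⟩ := L.block s k₁ p hs1 (fun h => hes h.1) hp sp k1p
  have hkr := L.block_sep k₁ k p r hp hr hpr k1p k1r hk
  have hkq := L.block_sep s k p q hp hq hpq sp sq hk
  have hru := mul_neg_of_zero_between hpo hk hkr
  have hrq : 0 < L.h k r * L.h k q :=
    lt_of_le_of_ne (block_unsep hr hq k2r k2q Erq k) (mul_ne_zero hkr hkq).symm
  have hqu := mul_neg_of_mul_pos_of_mul_neg hrq hru
  have hkv : L.h k v = 0 := by
    by_contra h0
    have h1 : 0 < L.h k q * L.h k v :=
      lt_of_le_of_ne (block_unsep hq hv k2q k2v Eqv k) (mul_ne_zero hkq h0).symm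
    have h2 := mul_neg_of_mul_pos_of_mul_neg h1 hqu
    exact absurd (block_unsep hu hv lu lv Euv k) (not_le.mpr (by linarith))
  obtain ⟨w, hw, sw, hpw, Epw, j, hjs, hj⟩ := exists_next hp sp sq hpq fun e he h0 => by
    rcases eq_or_eq hs1 hp sp k1p h0 with rfl | rfl
    · exact hes he
    · exact he1 he
  have hwp : w ≠ p := by
    rintro rfl
    exact hpq (right_mem_openSegment_iff.mp hpw).symm
  have hqw := mul_neg_of_zero_between hpw hk hkq
  have hrw : L.h k r * L.h k w < 0 :=
    mul_neg_of_mul_pos_of_mul_neg (by linarith) hqw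
  have hjv := hS k k₂ k₁ s j r p w v hr hp hw hv k2r k1r k1p sp sw hj h12.symm hs1.symm hjs.symm
    hpr.symm hwp Epr Epw hk hrw hkv k2v
  rcases eq_or_eq h2l hv k2v lv hjv with rfl | rfl
  · have := eq_of_zero hs2 hw hq sw sq hj k2q
    subst this
    simp only [openSegment_same, mem_singleton_iff] at hpw
    exact absurd hpw hpq
  · exact ⟨w, hw, sw, hj, hpw, Epw⟩

/-- There is no quadrilateral cell `p q v u` next to a triangular cell `p q r`. -/
theorem false_of_quad [Finite ι] (hS : L.StrongStep) {s k₁ k₂ l : ι} {p q r u v : Pt}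
    (hp : p ∈ L.T) (hq : q ∈ L.T) (hr : r ∈ L.T) (hu : u ∈ L.T) (hv : v ∈ L.T)
    (hs1 : s ≠ k₁) (hs2 : s ≠ k₂) (h12 : k₁ ≠ k₂) (h1l : k₁ ≠ l) (h2l : k₂ ≠ l)
    (hes : ¬ L.edge s) (he1 : ¬ L.edge k₁) (he2 : ¬ L.edge k₂) (hpq : p ≠ q) (hpr : p ≠ r)
    (hqr : q ≠ r)
    (sp : L.f s p = 0) (sq : L.f s q = 0) (k1p : L.f k₁ p = 0) (k1r : L.f k₁ r = 0)
    (k1u : L.f k₁ u = 0) (k2q : L.f k₂ q = 0) (k2r : L.f k₂ r = 0) (k2v : L.f k₂ v = 0)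
    (lu : L.f l u = 0) (lv : L.f l v = 0) (hpo : p ∈ openSegment ℝ r u)
    (hqo : q ∈ openSegment ℝ r v)
    (Epr : L.Unsep p r) (Erq : L.Unsep r q) (Epu : L.Unsep p u) (Eqv : L.Unsep q v)
    (Euv : L.Unsep u v) : False := by
  obtain ⟨w, hw, sw, lw, hpw, -⟩ := exists_meet hS hp hq hr hu hv hs1 hs2 h12 h2l hes he1 hpq hpr
    sp sq k1p k1r k1u k2q k2r k2v lu lv hpo Epr Erq Eqv Euv
  obtain ⟨w', hw', sw', lw', hqw', -⟩ := exists_meet hS hq hp hr hv hu hs2 hs1 h12.symm h1l hes he2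
    hpq.symm hqr sq sp k2q k2r k2v k1p k1r k1u lv lu hqo Erq.symm Epr.symm Epu Euv.symm
  have hsl : s ≠ l := by
    rintro rfl
    have := eq_of_zero hs1 hu hp lu sp k1u k1p
    subst this
    exact hpr (right_mem_openSegment_iff.mp hpo).symm
  have := eq_of_zero hsl hw hw' sw sw' lw lw'
  subst this
  exact mem_openSegment_trans_false hpw hqw' k1p fun h0 =>
    hpq (eq_of_zero hs1 hp hq sp sq k1p h0)

theorem mul_pos_of_mul_pos_right {a b c : ℝ} (h1 : 0 < a * c) (h2 : 0 < b * c) : 0 < a * b := by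
  have hc : c ≠ 0 := fun h => by simp [h] at h1
  have h3 := mul_pos h1 h2
  have h4 : a * c * (b * c) = a * b * c ^ 2 := by ring
  rw [h4] at h3
  exact pos_of_mul_pos_left h3 (by positivity)

theorem mul_pos_of_mul_neg {a b c : ℝ} (h1 : a * c < 0) (h2 : b * c < 0) : 0 < a * b :=
  mul_pos_of_mul_pos_right (c := -c) (by linarith) (by linarith)

theorem mul_pos_of_zero_or {φ : Pt →ᵃ[ℝ] ℝ} {x y z : Pt} {r : ℝ}
    (hz : z ∈ openSegment ℝ x y ∨ z = y) (h0 : φ x = 0) (hy : 0 < φ y * r) : 0 < φ z * r := by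
  rcases hz with hz | rfl
  · have hy0 : φ y ≠ 0 := fun h => by simp [h] at hy
    exact mul_pos_of_mul_pos_right (mul_pos_of_zero_left hz h0 hy0) (by linarith)
  · exact hy

theorem mem_openSegment_of_mem {x y z w : Pt} (hy : y ∈ openSegment ℝ x w)
    (hz : z ∈ openSegment ℝ y w) : y ∈ openSegment ℝ x z := by
  obtain ⟨s, t, hs, ht, hst, hy'⟩ := hy
  obtain ⟨u, v, hu, hv, huv, hz'⟩ := hz
  have hpos : 0 < v + t * u := by positivity
  refine ⟨s * v / (v + t * u), t / (v + t * u), by positivity, by positivity, ?_, ?_⟩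
  · field_simp
    linear_combination v * hst - t * huv
  · have h1 : (s * v / (v + t * u)) • x + (t / (v + t * u)) • z =
        (v + t * u)⁻¹ • (v • (s • x + t • w) + (t * u) • y) := by
      rw [← hz']; module
    rw [h1, hy', ← add_smul, smul_smul, inv_mul_cancel₀ hpos.ne', one_smul]

/-- The first vertex met on the way from `a` to `b`. -/
theorem exists_first [Finite ι] {i s : ι} {a b : Pt} (ha : a ∈ L.T) (hb : b ∈ L.T)
    (hai : L.f i a = 0) (hbi : L.f i b = 0) (hs : L.f s a * L.f s b < 0) :
    ∃ w ∈ openSegment ℝ a b, L.Unsep a w ∧ ∃ j, j ≠ i ∧ L.f j w = 0 := by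
  have hab : b - a ≠ 0 := fun h0 => by
    rw [sub_eq_zero.mp h0] at hs
    exact absurd hs (not_lt.mpr (mul_self_nonneg _))
  have hlin : ∀ k, (L.f k).linear (b - a) = L.f k b - L.f k a := fun k => by
    have := (L.f k).linearMap_vsub b a
    simpa only [vsub_eq_sub] using this
  obtain ⟨t, ht, -, -, hE, hj⟩ := exists_ray ha hai hab (by rw [hlin, hai, hbi, sub_zero])
    fun e he h0 => by rw [hlin, h0, sub_zero]; exact (L.mem_T b).mp hb e he
  refine ⟨_, ⟨1 - t, t, ?_, ht, by ring, by module⟩, hE, hj⟩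
  by_contra hc
  have h1 : L.f s (a + t • (b - a)) = L.f s a + t * (L.f s b - L.f s a) := by
    have := (L.f s).map_vadd a (t • (b - a))
    simp only [vadd_eq_add, map_smul, smul_eq_mul, hlin] at this
    rw [add_comm a, this, add_comm]
  have h2 := hE s
  rw [h1] at h2
  nlinarith [mul_pos ht (neg_pos.mpr hs), mul_nonneg (show 0 ≤ t - 1 by linarith)
    (mul_self_nonneg (L.f s a))]

variable (L) in
/-- A triangle bounded by the lines `i = ab`, `j = bc`, `k = ac`, at most one of them an edge. -/
structure IsTriangle (i j k : ι) (a b c : Pt) : Prop where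
  ha : a ∈ L.T
  hb : b ∈ L.T
  hc : c ∈ L.T
  ia : L.f i a = 0
  ib : L.f i b = 0
  jb : L.f j b = 0
  jc : L.f j c = 0
  ka : L.f k a = 0
  kc : L.f k c = 0
  ij : i ≠ j
  ik : i ≠ k
  jk : j ≠ k
  eij : ¬ (L.edge i ∧ L.edge j)
  eik : ¬ (L.edge i ∧ L.edge k)
  ejk : ¬ (L.edge j ∧ L.edge k)

variable (L) in
/-- The lines separating two of the points `a`, `b`, `c`. -/
def cuts (a b c : Pt) : Set ι :=
  {n | L.f n a * L.f n b < 0 ∨ L.f n b * L.f n c < 0 ∨ L.f n a * L.f n c < 0}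

variable (L) in
/-- The cell at the corner `a` of the triangle `a b c` is a triangle. -/
def CornerCell (a b c : Pt) : Prop := ∃ m q y, (q ∈ openSegment ℝ a b ∨ q = b) ∧
  (y ∈ openSegment ℝ a c ∨ y = c) ∧ L.f m q = 0 ∧ L.f m y = 0 ∧
  L.Unsep a q ∧ L.Unsep a y ∧ L.Unsep q y

theorem CornerCell.swap {a b c : Pt} : L.CornerCell a b c → L.CornerCell a c b := by
  rintro ⟨m, q, y, hq, hy, mq, my, h1, h2, h3⟩
  exact ⟨m, y, q, hy, hq, my, mq, h2, h1, h3.symm⟩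

namespace IsTriangle

variable {i j k : ι} {a b c : Pt}

theorem swap (t : L.IsTriangle i j k a b c) : L.IsTriangle k j i a c b :=
  ⟨t.ha, t.hc, t.hb, t.ka, t.kc, t.jc, t.jb, t.ia, t.ib, t.jk.symm, t.ik.symm, t.ij.symm,
    fun h => t.ejk h.symm, fun h => t.eik h.symm, fun h => t.eij h.symm⟩

theorem swap' (t : L.IsTriangle i j k a b c) : L.IsTriangle i k j b a c :=
  ⟨t.hb, t.ha, t.hc, t.ib, t.ia, t.ka, t.kc, t.jb, t.jc, t.ik, t.ij, t.jk.symm,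
    t.eik, t.eij, fun h => t.ejk h.symm⟩

theorem cuts_swap : L.cuts a c b = L.cuts a b c := by
  ext n; simp only [cuts, mem_ofPred_eq, mul_comm (L.f n c) (L.f n b)]; tauto

theorem cuts_swap' : L.cuts b a c = L.cuts a b c := by
  ext n; simp only [cuts, mem_ofPred_eq, mul_comm (L.f n b) (L.f n a)]; tauto

theorem ne_ab (t : L.IsTriangle i j k a b c) : a ≠ b := by
  rintro rfl
  exact L.no_three i j k a t.ij t.ik t.jk t.ha t.ia t.jb t.ka

/-- A line separating `a` from `b` and `c` cuts off a smaller triangle at `a`. -/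
theorem sub [Finite ι] (t : L.IsTriangle i j k a b c) {s : ι} {q y : Pt}
    (hq : q ∈ openSegment ℝ a b) (hy : y ∈ openSegment ℝ a c) (sq : L.f s q = 0)
    (sy : L.f s y = 0) (sab : L.f s a * L.f s b < 0) :
    L.IsTriangle i s k a q y ∧ (L.cuts a q y).ncard < (L.cuts a b c).ncard := by
  have hsa : L.f s a ≠ 0 := left_ne_zero_of_mul sab.ne
  have hes := not_edge_of_mul_neg t.ha t.hb sab
  refine ⟨⟨t.ha, mem_of_openSegment t.ha t.hb hq, mem_of_openSegment t.ha t.hc hy, t.ia,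
    zero_of_zero hq t.ia t.ib, sq, sy, t.ka, zero_of_zero hy t.ka t.kc, ?_, t.ik, ?_,
    fun h => hes h.2, t.eik, fun h => hes h.1⟩, ?_⟩
  · rintro rfl; exact hsa t.ia
  · rintro rfl; exact hsa t.ka
  refine Set.ncard_lt_ncard ⟨?_, fun hsub => ?_⟩ (Set.toFinite _)
  · rintro n (h | h | h)
    · exact Or.inl (mul_neg_extend hq h)
    · obtain ⟨s₁, t₁, hs₁, ht₁, -, h₁⟩ := openSegment_affine hq
      obtain ⟨s₂, t₂, hs₂, ht₂, -, h₂⟩ := openSegment_affine hy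
      by_contra hc
      simp only [cuts, mem_ofPred_eq, not_or, not_lt] at hc
      obtain ⟨c1, c2, c3⟩ := hc
      rw [h₁, h₂] at h
      have e1 := mul_nonneg (mul_nonneg ht₁.le hs₂.le) c1
      have e2 := mul_nonneg (mul_nonneg ht₁.le ht₂.le) c2
      have e3 := mul_nonneg (mul_nonneg hs₁.le ht₂.le) c3
      have e4 := mul_nonneg (mul_nonneg hs₁.le hs₂.le) (mul_self_nonneg (L.f n a))
      nlinarith
    · exact Or.inr (Or.inr (mul_neg_extend hy h))
  · have := hsub (show s ∈ L.cuts a b c from Or.inl sab)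
    simp [cuts, sq, sy] at this

/-- Without lines cutting off `a`, a line separating `a` from `b` cuts off `b`. -/
theorem cut_of (t : L.IsTriangle i j k a b c)
    (hno : ∀ n, L.f n a * L.f n b < 0 → L.f n a * L.f n c < 0 → False) {n : ι}
    (hn : L.f n a * L.f n b < 0) : L.f n b * L.f n c < 0 := by
  have h0 : L.f n c ≠ 0 := fun h0 => by
    rcases eq_or_eq t.jk t.hc t.jc t.kc h0 with rfl | rfl
    · simp [t.jb] at hn
    · simp [t.ka] at hn
  have h1 : 0 < L.f n a * L.f n c :=
    lt_of_le_of_ne (not_lt.mp fun h => hno n hn h) (mul_ne_zero (left_ne_zero_of_mul hn.ne) h0).symm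
  rw [mul_comm]
  exact mul_neg_of_mul_pos_of_mul_neg h1 hn

theorem cut_cases (t : L.IsTriangle i j k a b c)
    (hno : ∀ n, L.f n a * L.f n b < 0 → L.f n a * L.f n c < 0 → False) {n : ι}
    (hn : n ∈ L.cuts a b c) : (L.f n b * L.f n a < 0 ∧ L.f n b * L.f n c < 0) ∨
      (L.f n c * L.f n a < 0 ∧ L.f n c * L.f n b < 0) := by
  have hB : L.f n a * L.f n b < 0 → (L.f n b * L.f n a < 0 ∧ L.f n b * L.f n c < 0) :=
    fun h => ⟨by linarith, t.cut_of hno h⟩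
  have hC : L.f n a * L.f n c < 0 → (L.f n c * L.f n a < 0 ∧ L.f n c * L.f n b < 0) :=
    fun h => ⟨by linarith, t.swap.cut_of (fun n h1 h2 => hno n h2 h1) h⟩
  rcases hn with h | h | h
  · exact Or.inl (hB h)
  · have ha : L.f n a ≠ 0 := fun h0 => by
      rcases eq_or_eq t.ik t.ha t.ia t.ka h0 with rfl | rfl
      · simp [t.ib] at h
      · simp [t.kc] at h
    by_cases h1 : L.f n a * L.f n b < 0
    · exact Or.inl (hB h1)
    · refine Or.inr (hC ?_)
      have hb : L.f n b ≠ 0 := left_ne_zero_of_mul h.ne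
      have h2 : 0 < L.f n b * L.f n a :=
        lt_of_le_of_ne (by linarith) (mul_ne_zero hb ha).symm
      exact mul_neg_of_mul_pos_of_mul_neg h2 h
  · exact Or.inr (hC h)

theorem false_of_cut_aux [Finite ι] (hS : L.StrongStep) (t : L.IsTriangle i j k a b c)
    (hej : ¬ L.edge j) (hek : ¬ L.edge k) {s : ι} {q z : Pt} (hq : q ∈ openSegment ℝ a b)
    (hz : z ∈ openSegment ℝ c b) (sq : L.f s q = 0) (sz : L.f s z = 0)
    (sa : L.f s b * L.f s a < 0) (sc : L.f s b * L.f s c < 0) (Ebq : L.Unsep b q)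
    (Ebz : L.Unsep b z) (Eqz : L.Unsep q z) (Eaq : L.Unsep a q) (Ezc : L.Unsep z c)
    (Eac : L.Unsep a c) : False := by
  have hes := not_edge_of_mul_neg t.hb t.ha sa
  have hsb : L.f s b ≠ 0 := left_ne_zero_of_mul sa.ne
  have hsa : L.f s a ≠ 0 := right_ne_zero_of_mul sa.ne
  have hsc : L.f s c ≠ 0 := right_ne_zero_of_mul sc.ne
  have hsi : s ≠ i := by rintro rfl; exact hsb t.ib
  have hsj : s ≠ j := by rintro rfl; exact hsb t.jb
  have hsk : s ≠ k := by rintro rfl; exact hsa t.ka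
  have iq := zero_of_zero hq t.ia t.ib
  have jz := zero_of_zero hz t.jc t.jb
  have hqT := mem_of_openSegment t.ha t.hb hq
  have hzT := mem_of_openSegment t.hc t.hb hz
  have hzb : z ≠ b := by rintro rfl; exact hsb sz
  have hzq : z ≠ q := by
    rintro rfl; exact L.no_three i j s z t.ij hsi.symm hsj.symm hzT iq jz sz
  obtain ⟨w, hw, sw, kw, hzw, Ezw⟩ := exists_meet hS (s := s) (k₁ := j) (k₂ := i) (l := k)
    (p := z) (q := q) (r := b) (u := c) (v := a) hzT hqT t.hb t.hc t.ha hsj hsi t.ij.symm t.ik hes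
    hej hzq hzb sz sq jz t.jb t.jc iq t.ib t.ia t.kc t.ka (mem_openSegment_swap hz) Ebz.symm Ebq
    Eaq.symm Eac.symm
  have hjq : L.f j q ≠ 0 := fun h0 => by
    have := eq_of_zero t.ij hqT t.hb iq t.ib h0 t.jb
    subst this; exact hsb sq
  have hja : L.f j a ≠ 0 := fun h0 => L.no_three i j k a t.ij t.ik t.jk t.ha t.ia h0 t.ka
  have Ewc : L.Unsep w c := by
    intro n
    by_contra hc
    push Not at hc
    have h1 := Ezw n
    have h2 := Ezc n
    have hz0 : L.f n z = 0 := by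
      by_contra h0
      have hw0 := left_ne_zero_of_mul hc.ne
      exact absurd h2 (not_le.mpr (by
        have := mul_neg_of_mul_pos_of_mul_neg
          (show 0 < L.f n w * L.f n z by
            rw [mul_comm]; exact lt_of_le_of_ne h1 (mul_ne_zero h0 hw0).symm) hc
        exact this))
    rcases eq_or_eq hsj hzT sz jz hz0 with rfl | rfl
    · simp [sw] at hc
    · simp [t.jc] at hc
  have hca : c ∈ openSegment ℝ w a := by
    have h1 := mul_neg_of_zero_between hzw jz hjq
    have h2 := mul_pos_of_zero_left (mem_openSegment_swap hq) t.jb hja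
    have h3 := mul_neg_of_mul_pos_of_mul_neg h2 h1
    rw [mul_comm] at h3
    obtain ⟨c', hc', hc'0⟩ := exists_zero_of_mul_neg h3
    have := eq_of_zero t.jk t.hc (mem_of_openSegment hw t.ha hc') t.jc hc'0 t.kc
      (zero_of_zero hc' kw t.ka)
    rwa [this]
  refine false_of_quad hS (s := j) (k₁ := s) (k₂ := k) (l := i) (p := z) (q := c) (r := w) (u := q)
    (v := a) hzT t.hc hw hqT t.ha hsj.symm t.jk hsk hsi t.ik.symm hej hes hek ?_ ?_ ?_ jz t.jc sz sw
    sq t.kc kw t.ka iq t.ia (mem_openSegment_swap hzw) hca Ezw Ewc Eqz.symm Eac.symm Eaq.symm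
  · rintro rfl; exact hsc sz
  · rintro rfl; exact hzq (right_mem_openSegment_iff.mp hzw).symm
  · rintro rfl; exact hsc sw

/-- A triangle is not divided by a single line into two cells. -/
theorem false_of_cut [Finite ι] (hS : L.StrongStep) (t : L.IsTriangle i j k a b c)
    {s : ι} {q z : Pt} (hq : q ∈ openSegment ℝ a b)
    (hz : z ∈ openSegment ℝ c b) (sq : L.f s q = 0) (sz : L.f s z = 0)
    (sa : L.f s b * L.f s a < 0) (sc : L.f s b * L.f s c < 0) (Eaq : L.Unsep a q)
    (Eqb : L.Unsep q b) (Eqz : L.Unsep q z) (Ebz : L.Unsep b z)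
    (hcuts : ∀ n ∈ L.cuts a b c, n = s) : False := by
  have hsb : L.f s b ≠ 0 := left_ne_zero_of_mul sa.ne
  have Ezc : L.Unsep z c := by
    intro n
    by_contra h
    push Not at h
    have := hcuts n (Or.inr (Or.inl (by
      have := mul_neg_extend hz (by rw [mul_comm]; exact h); linarith)))
    subst this
    simp [sz] at h
  have Eac : L.Unsep a c := by
    intro n
    by_contra h
    have := hcuts n (Or.inr (Or.inr (not_le.mp h)))
    subst this
    exact h (mul_pos_of_mul_neg (c := L.f n b) (by linarith) (by linarith)).le
  by_cases hek : L.edge k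
  · have hei : ¬ L.edge i := fun h => t.eik ⟨h, hek⟩
    have hej : ¬ L.edge j := fun h => t.ejk ⟨h, hek⟩
    have hsi : s ≠ i := by rintro rfl; exact hsb t.ib
    have hsj : s ≠ j := by rintro rfl; exact hsb t.jb
    have iq := zero_of_zero hq t.ia t.ib
    have jz := zero_of_zero hz t.jc t.jb
    have hqT := mem_of_openSegment t.ha t.hb hq
    have hzT := mem_of_openSegment t.hc t.hb hz
    refine false_of_quad hS (s := s) (k₁ := i) (k₂ := j) (l := k) (p := q) (q := z) (r := b)
      (u := a) (v := c) hqT hzT t.hb t.ha t.hc hsi hsj t.ij t.ik t.jk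
      (not_edge_of_mul_neg t.hb t.ha sa) hei hej ?_ ?_ ?_ sq sz iq t.ib t.ia jz t.jb t.jc t.ka t.kc
      (mem_openSegment_swap hq) (mem_openSegment_swap hz) Eqb Ebz Eaq.symm Ezc Eac
    · rintro rfl; exact L.no_three i j s q t.ij hsi.symm hsj.symm hzT iq jz sz
    · rintro rfl; exact hsb sq
    · rintro rfl; exact hsb sz
  · by_cases hej : L.edge j
    · exact false_of_cut_aux hS (i := j) (j := i) (k := k) (a := c) (b := b) (c := a)
        t.swap.swap'.swap (fun h => t.eij ⟨h, hej⟩) hek hz hq sz sq sc sa Ebz Eqb.symm Eqz.symm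
        Ezc.symm Eaq.symm Eac.symm
    · exact false_of_cut_aux hS t hej hek hq hz sq sz sa sc Eqb.symm Ebz Eqz Eaq Ezc Eac

end IsTriangle

theorem mem_openSegment_shrink {x y z w : Pt} (hy : y ∈ openSegment ℝ x w)
    (hz : z ∈ openSegment ℝ x y) : z ∈ openSegment ℝ x w := by
  obtain ⟨s, t, hs, ht, hst, rfl⟩ := hy
  obtain ⟨u, v, hu, hv, huv, rfl⟩ := hz
  refine ⟨u + v * s, v * t, by positivity, by positivity, ?_, by module⟩
  linear_combination huv + v * hst

namespace IsTriangle

variable {i j k : ι} {a b c : Pt}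

/-- If no line cuts off `a` but some line cuts off `b`, then there is only one such line, and it
cuts off a triangular cell. -/
theorem exists_last_cut [Finite ι] (t : L.IsTriangle i j k a b c)
    (ih : ∀ i' j' k' a' b' c', L.IsTriangle i' j' k' a' b' c' →
      (L.cuts a' b' c').ncard < (L.cuts a b c).ncard → L.CornerCell a' b' c')
    (hno : ∀ n, L.f n a * L.f n b < 0 → L.f n a * L.f n c < 0 → False) {s₀ : ι}
    (hs₀ : L.f s₀ b * L.f s₀ a < 0) :
    ∃ s, ∃ q ∈ openSegment ℝ a b, ∃ z ∈ openSegment ℝ c b, L.f s q = 0 ∧ L.f s z = 0 ∧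
      L.f s b * L.f s a < 0 ∧ L.f s b * L.f s c < 0 ∧ L.Unsep a q ∧ L.Unsep q b ∧
      L.Unsep q z ∧ L.Unsep b z ∧
      ∀ n, L.f n b * L.f n a < 0 → n = s := by
  obtain ⟨q, hq, Eaq, s, hsi, sq⟩ := exists_first t.ha t.hb t.ia t.ib
    (by linarith : L.f s₀ a * L.f s₀ b < 0)
  have hqa : q ≠ a := ne_of_mem_openSegment t.ne_ab hq
  have hqb : q ≠ b := ne_of_mem_openSegment t.ne_ab.symm (mem_openSegment_swap hq)
  have hqT := mem_of_openSegment t.ha t.hb hq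
  have iq := zero_of_zero hq t.ia t.ib
  have sa0 : L.f s a ≠ 0 := fun h0 => hqa (eq_of_zero hsi hqT t.ha sq h0 iq t.ia)
  have sa : L.f s a * L.f s b < 0 := mul_neg_of_zero_between hq sq sa0
  have sc := t.cut_of hno sa
  have sb0 : L.f s b ≠ 0 := right_ne_zero_of_mul sa.ne
  have hsj : s ≠ j := by rintro rfl; exact sb0 t.jb
  have sa' : L.f s b * L.f s a < 0 := by linarith
  obtain ⟨z, hz, sz⟩ := exists_zero_of_mul_neg (by linarith : L.f s c * L.f s b < 0)
  have hzT := mem_of_openSegment t.hc t.hb hz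
  have jz := zero_of_zero hz t.jc t.jb
  have hzq : q ≠ z := by
    rintro rfl; exact L.no_three i j s q t.ij hsi.symm hsj.symm hzT iq jz sq
  obtain ⟨ts, hlt⟩ := t.swap'.sub (mem_openSegment_swap hq) (mem_openSegment_swap hz) sq sz sa'
  rw [cuts_swap' (a := a)] at hlt
  have main : L.Unsep q b ∧ L.Unsep q z ∧ L.Unsep b z := by
    obtain ⟨m, q₂, z₂, hq₂, hz₂, mq₂, mz₂, E1, E2, E3⟩ := ih _ _ _ _ _ _ ts.swap'
      (by rw [cuts_swap']; exact hlt)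
    have sz₂ : L.f s z₂ = 0 := by
      rcases hz₂ with hz₂ | rfl
      · exact zero_of_zero hz₂ sq sz
      · exact sz
    have hz₂T : z₂ ∈ L.T := by
      rcases hz₂ with hz₂ | rfl
      · exact mem_of_openSegment hqT hzT hz₂
      · exact hzT
    have hqz₂ : q ≠ z₂ := by
      rcases hz₂ with hz₂ | rfl
      · exact (ne_of_mem_openSegment hzq hz₂).symm
      · exact hzq
    have hmi : m ≠ i := by
      rintro rfl
      exact hqz₂ (eq_of_zero hsi hqT hz₂T sq sz₂ iq mz₂)
    rcases hq₂ with hq₂ | rfl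
    · exfalso
      have iq₂ := zero_of_zero hq₂ iq t.ib
      have hq₂T := mem_of_openSegment hqT t.hb hq₂
      have hqq₂ : q₂ ≠ q := ne_of_mem_openSegment hqb hq₂
      have hq₂b : q₂ ≠ b := ne_of_mem_openSegment hqb.symm (mem_openSegment_swap hq₂)
      have mq0 : L.f m q ≠ 0 := fun h0 => hqq₂ (eq_of_zero hmi hq₂T hqT mq₂ h0 iq₂ iq)
      have mqb := mul_neg_of_zero_between hq₂ mq₂ mq0
      have mba : L.f m b * L.f m a < 0 :=
        mul_neg_extend (mem_openSegment_swap hq) (by linarith)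
      have mbc := t.cut_of hno (by linarith : L.f m a * L.f m b < 0)
      obtain ⟨z₃, hz₃, mz₃⟩ := exists_zero_of_mul_neg (by linarith : L.f m c * L.f m b < 0)
      have hz₃T := mem_of_openSegment t.hc t.hb hz₃
      have hbq₂ : q₂ ∈ openSegment ℝ b a :=
        mem_openSegment_shrink (mem_openSegment_swap hq) (mem_openSegment_swap hq₂)
      obtain ⟨tm, hlt'⟩ := t.swap'.sub hbq₂ (mem_openSegment_swap hz₃) mq₂ mz₃ mba
      rw [cuts_swap' (a := a)] at hlt'
      obtain ⟨n, q₃, z₄, hq₃, hz₄, nq₃, nz₄, -, -, F3⟩ := ih _ _ _ _ _ _ tm.swap'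
        (by rw [cuts_swap']; exact hlt')
      have mz₄ : L.f m z₄ = 0 := by
        rcases hz₄ with hz₄ | rfl
        · exact zero_of_zero hz₄ mq₂ mz₃
        · exact mz₃
      have hz₄T : z₄ ∈ L.T := by
        rcases hz₄ with hz₄ | rfl
        · exact mem_of_openSegment hq₂T hz₃T hz₄
        · exact hz₃T
      have hq₃T : q₃ ∈ L.T := by
        rcases hq₃ with hq₃ | rfl
        · exact mem_of_openSegment hq₂T t.hb hq₃
        · exact t.hb
      have hq₂o : q₂ ∈ openSegment ℝ q q₃ := by
        rcases hq₃ with hq₃ | rfl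
        · exact mem_openSegment_of_mem hq₂ hq₃
        · exact hq₂
      have ic0 : L.f i c ≠ 0 := fun h0 => L.no_three i j k c t.ij t.ik t.jk t.hc h0 t.jc t.kc
      have s1 := mul_pos_of_zero_or hz₂ iq
        (mul_pos_of_zero_left (mem_openSegment_swap hz) t.ib ic0)
      have s2 := mul_pos_of_zero_or hz₄ iq₂
        (mul_pos_of_zero_left (mem_openSegment_swap hz₃) t.ib ic0)
      refine false_of_adjacent hmi.symm
        (fun h => not_edge_of_mul_neg t.hb t.ha mba h.2) hq₂T hqT hq₃T hz₂T hz₄T hqq₂ ?_ iq₂ mq₂ iq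
        mz₂ mz₄ hq₂o (mul_pos_of_mul_pos_right s1 s2) sq sz₂ nq₃ nz₄ E2 F3
      rintro rfl
      exact hqq₂ (eq_of_zero hsi hq₂T hqT sz₂ sq iq₂ iq)
    · have hmj : m = j := (eq_or_eq t.ij t.hb t.ib t.jb mq₂).resolve_left hmi
      subst hmj
      have := eq_of_zero hsj hz₂T hzT sz₂ sz mz₂ jz
      subst this
      exact ⟨E1, E2, E3⟩
  obtain ⟨Eqb, Eqz, Ebz⟩ := main
  refine ⟨s, q, hq, z, hz, sq, sz, sa', sc, Eaq, Eqb, Eqz, Ebz, fun n hn => ?_⟩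
  by_contra hns
  have hna : L.f n a ≠ 0 := right_ne_zero_of_mul hn.ne
  have hnq : L.f n q ≠ 0 := fun h0 => by
    rcases eq_or_eq hsi hqT sq iq h0 with rfl | rfl
    · exact hns rfl
    · exact hna t.ia
  have h1 : 0 < L.f n a * L.f n q := lt_of_le_of_ne (Eaq n) (mul_ne_zero hna hnq).symm
  have h2 := mul_neg_of_mul_pos_of_mul_neg h1 (by linarith : L.f n a * L.f n b < 0)
  exact absurd (Eqb n) (not_le.mpr h2)

/-- There is no pentagonal cell obtained from a triangle by cutting off two corners. -/
theorem false_of_two_cuts [Finite ι] (hS : L.StrongStep) (t : L.IsTriangle i j k a b c)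
    {s u : ι} {q z y w : Pt} (hq : q ∈ openSegment ℝ a b) (hz : z ∈ openSegment ℝ c b)
    (hy : y ∈ openSegment ℝ a c) (hw : w ∈ openSegment ℝ b c)
    (sq : L.f s q = 0) (sz : L.f s z = 0) (uy : L.f u y = 0) (uw : L.f u w = 0)
    (sa : L.f s b * L.f s a < 0) (sc : L.f s b * L.f s c < 0)
    (ua : L.f u c * L.f u a < 0) (ub : L.f u c * L.f u b < 0)
    (Eaq : L.Unsep a q) (Eqb : L.Unsep q b) (Eqz : L.Unsep q z) (Ebz : L.Unsep b z)
    (Eay : L.Unsep a y) (Eyw : L.Unsep y w) (hcuts : ∀ n ∈ L.cuts a b c, n = s ∨ n = u) :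
    False := by
  have hes := not_edge_of_mul_neg t.hb t.ha sa
  have hsb : L.f s b ≠ 0 := left_ne_zero_of_mul sa.ne
  have huc : L.f u c ≠ 0 := left_ne_zero_of_mul ua.ne
  have hub : L.f u b ≠ 0 := right_ne_zero_of_mul ub.ne
  have hua : L.f u a ≠ 0 := right_ne_zero_of_mul ua.ne
  have hsi : s ≠ i := by rintro rfl; exact hsb t.ib
  have hsj : s ≠ j := by rintro rfl; exact hsb t.jb
  have huj : u ≠ j := by rintro rfl; exact huc t.jc
  have huk : u ≠ k := by rintro rfl; exact huc t.kc
  have hsu : s ≠ u := by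
    rintro rfl
    exact absurd (mul_pos_of_mul_neg (c := L.f s a) sa ua) (by linarith)
  have iq := zero_of_zero hq t.ia t.ib
  have jz := zero_of_zero hz t.jc t.jb
  have jw := zero_of_zero hw t.jb t.jc
  have ky := zero_of_zero hy t.ka t.kc
  have hqT := mem_of_openSegment t.ha t.hb hq
  have hzT := mem_of_openSegment t.hc t.hb hz
  have hyT := mem_of_openSegment t.ha t.hc hy
  have hwT := mem_of_openSegment t.hb t.hc hw
  have hqz : q ≠ z := by
    rintro rfl; exact L.no_three i j s q t.ij hsi.symm hsj.symm hzT iq jz sq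
  have hwz : w ≠ z := by
    rintro rfl; exact L.no_three u j s w huj hsu.symm hsj.symm hzT uw jz sz
  have hbz : b ≠ z := by rintro rfl; exact hsb sz
  have huz : L.f u z ≠ 0 := fun h0 => hwz (eq_of_zero huj hwT hzT uw h0 jw jz)
  have h1 : 0 < L.f u b * L.f u z := lt_of_le_of_ne (Ebz u) (mul_ne_zero hub huz).symm
  have h2 := mul_neg_of_mul_pos_of_mul_neg h1 (by linarith : L.f u b * L.f u c < 0)
  obtain ⟨w', hw', uw'⟩ := exists_zero_of_mul_neg h2
  have hww' := eq_of_zero huj (mem_of_openSegment hzT t.hc hw') hwT uw' uw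
    (zero_of_zero hw' jz t.jc) jw
  subst hww'
  have hzo := mem_openSegment_of_mem (mem_openSegment_swap hz) hw'
  have Ezw : L.Unsep z w' := by
    intro n
    by_contra h
    have h3 := mul_neg_extend hw' (not_le.mp h)
    have h4 := mul_neg_extend hz (by linarith : L.f n c * L.f n z < 0)
    rcases hcuts n (Or.inr (Or.inl (by linarith))) with rfl | rfl
    · simp [sz] at h
    · simp [uw] at h
  obtain ⟨m, hm⟩ := L.block s j z hsj (fun h => hes h.1) hzT sz jz
  have mb := L.block_sep j m z b hzT t.hb hbz.symm jz t.jb hm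
  have mq := L.block_sep s m z q hzT hqT hqz.symm sz sq hm
  have h3 := mul_neg_of_zero_between hzo hm mb
  have h4 : 0 < L.h m b * L.h m q :=
    lt_of_le_of_ne (by rw [mul_comm]; exact block_unsep hqT t.hb iq t.ib Eqb m)
      (mul_ne_zero mb mq).symm
  have h5 := mul_neg_of_mul_pos_of_mul_neg h4 h3
  by_cases ma : L.h m a = 0
  · exact hua (hS m i s j u q z w' a hqT hzT hwT t.ha iq sq sz jz jw uw hsi.symm hsj huj.symm hqz
      hwz Eqz.symm Ezw hm h5 ma t.ia)
  · by_cases my : L.h m y = 0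
    · have iy := hS m u j s i w' z q y hwT hzT hqT hyT uw jw jz sz sq iq huj hsj.symm hsi hwz hqz
        Ezw Eqz.symm hm (by linarith) my uy
      have := eq_of_zero t.ik hyT t.ha iy t.ia ky t.ka
      subst this
      exact hua uy
    · have e1 : 0 < L.h m a * L.h m q :=
        lt_of_le_of_ne (block_unsep t.ha hqT t.ia iq Eaq m) (mul_ne_zero ma mq).symm
      have e2 : 0 < L.h m y * L.h m a := lt_of_le_of_ne
        (by rw [mul_comm]; exact block_unsep t.ha hyT t.ka ky Eay m) (mul_ne_zero my ma).symm
      have e3 := mul_pos_of_mul_pos_right e2 (by linarith : 0 < L.h m q * L.h m a)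
      have e4 := mul_neg_of_mul_pos_of_mul_neg (by linarith : 0 < L.h m q * L.h m y) h5
      exact absurd (block_unsep hyT hwT uy uw Eyw m) (not_le.mpr e4)

/-- The corner cells of a triangle are triangles. -/
theorem cornerCell [Finite ι] (hS : L.StrongStep) (t : L.IsTriangle i j k a b c) :
    L.CornerCell a b c := by
  induction hN : (L.cuts a b c).ncard using Nat.strong_induction_on generalizing i j k a b c with
  | _ N IH =>
  have ih : ∀ i' j' k' a' b' c', L.IsTriangle i' j' k' a' b' c' →
      (L.cuts a' b' c').ncard < (L.cuts a b c).ncard → L.CornerCell a' b' c' :=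
    fun i' j' k' a' b' c' t' h => IH _ (hN ▸ h) t' rfl
  by_cases hno : ∀ n, L.f n a * L.f n b < 0 → L.f n a * L.f n c < 0 → False
  · have hno' : ∀ n, L.f n a * L.f n c < 0 → L.f n a * L.f n b < 0 → False :=
      fun n h1 h2 => hno n h2 h1
    have ih' : ∀ i' j' k' a' b' c', L.IsTriangle i' j' k' a' b' c' →
      (L.cuts a' b' c').ncard < (L.cuts a c b).ncard → L.CornerCell a' b' c' := by
      rw [cuts_swap]; exact ih
    by_cases hB : ∃ s, L.f s b * L.f s a < 0
    · obtain ⟨s₀, hs₀⟩ := hB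
      obtain ⟨s, q, hq, z, hz, sq, sz, sa, sc, Eaq, Eqb, Eqz, Ebz, hs⟩ :=
        t.exists_last_cut ih hno hs₀
      exfalso
      by_cases hC : ∃ u, L.f u c * L.f u a < 0
      · obtain ⟨u₀, hu₀⟩ := hC
        obtain ⟨u, y, hy, w, hw, uy, uw, ua, ub, Eay, -, Eyw, -, hu⟩ :=
          t.swap.exists_last_cut ih' hno' hu₀
        refine t.false_of_two_cuts hS hq hz hy hw sq sz uy uw sa sc ua ub Eaq Eqb Eqz Ebz Eay Eyw
          fun n hn => ?_
        rcases t.cut_cases hno hn with h | h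
        · exact Or.inl (hs n h.1)
        · exact Or.inr (hu n h.1)
      · refine t.false_of_cut hS hq hz sq sz sa sc Eaq Eqb Eqz Ebz fun n hn => ?_
        rcases t.cut_cases hno hn with h | h
        · exact hs n h.1
        · exact absurd ⟨n, h.1⟩ hC
    · by_cases hC : ∃ u, L.f u c * L.f u a < 0
      · obtain ⟨u₀, hu₀⟩ := hC
        obtain ⟨u, y, hy, w, hw, uy, uw, ua, ub, Eay, Eyc, Eyw, Ecw, hu⟩ :=
          t.swap.exists_last_cut ih' hno' hu₀
        exfalso
        refine t.swap.false_of_cut hS hy hw uy uw ua ub Eay Eyc Eyw Ecw fun n hn => ?_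
        rw [cuts_swap] at hn
        rcases t.cut_cases hno hn with h | h
        · exact absurd ⟨n, h.1⟩ hB
        · exact hu n h.1
      · have hcut : ∀ n ∉ L.cuts a b c, 0 ≤ L.f n a * L.f n b ∧ 0 ≤ L.f n b * L.f n c ∧
            0 ≤ L.f n a * L.f n c := fun n h => by
          simpa only [cuts, mem_ofPred_eq, not_or, not_lt] using h
        have hnone : ∀ n, n ∉ L.cuts a b c := fun n hn => by
          rcases t.cut_cases hno hn with h | h
          · exact hB ⟨n, h.1⟩
          · exact hC ⟨n, h.1⟩
        exact ⟨j, b, c, Or.inr rfl, Or.inr rfl, t.jb, t.jc, fun n => (hcut n (hnone n)).1,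
          fun n => (hcut n (hnone n)).2.2, fun n => (hcut n (hnone n)).2.1⟩
  · push Not at hno
    obtain ⟨s, sb, sc⟩ := hno
    obtain ⟨q, hq, sq⟩ := exists_zero_of_mul_neg sb
    obtain ⟨y, hy, sy⟩ := exists_zero_of_mul_neg sc.1
    obtain ⟨t', hlt⟩ := t.sub hq hy sq sy sb
    obtain ⟨m, q', y', hq', hy', h⟩ := ih _ _ _ _ _ _ t' hlt
    refine ⟨m, q', y', Or.inl ?_, Or.inl ?_, h⟩
    · rcases hq' with hq' | rfl
      · exact mem_openSegment_shrink hq hq'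
      · exact hq
    · rcases hy' with hy' | rfl
      · exact mem_openSegment_shrink hy hy'
      · exact hy

end IsTriangle

/-- Triangles that lie opposite across the crossing `p` on the line `I` and share the line `J`
cannot coexist. -/
theorem false_of_two_triangles [Finite ι] (hS : L.StrongStep) {I J m n : ι} {p x x' y y' : Pt}
    (t : L.IsTriangle I m J p x y) (t' : L.IsTriangle I n J p x' y')
    (hp : p ∈ openSegment ℝ x x') (hs : 0 < L.f I y * L.f I y') : False := by
  obtain ⟨k, q, z, hq, hz, kq, kz, -, -, E⟩ := t.cornerCell hS
  obtain ⟨k', q', z', hq', hz', kq', kz', -, -, E'⟩ := t'.cornerCell hS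
  have mem : ∀ {u v w : Pt}, u ∈ L.T → v ∈ L.T → (w ∈ openSegment ℝ u v ∨ w = v) → w ∈ L.T := by
    rintro u v w hu hv (h | rfl)
    · exact mem_of_openSegment hu hv h
    · exact hv
  have zero : ∀ {i} {u v w : Pt}, L.f i u = 0 → L.f i v = 0 → (w ∈ openSegment ℝ u v ∨ w = v) →
      L.f i w = 0 := by
    rintro i u v w hu hv (h | rfl)
    · exact zero_of_zero h hu hv
    · exact hv
  have ne : ∀ {u v w : Pt}, u ≠ v → (w ∈ openSegment ℝ u v ∨ w = v) → u ≠ w := by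
    rintro u v w huv (h | rfl)
    · exact (ne_of_mem_openSegment huv h).symm
    · exact huv
  have hpq : p ∈ openSegment ℝ x q' := by
    rcases hq' with h | rfl
    · exact mem_openSegment_of_mem hp h
    · exact hp
  have hpq' : p ∈ openSegment ℝ q q' := by
    rcases hq with h | rfl
    · exact mem_openSegment_swap (mem_openSegment_of_mem (mem_openSegment_swap hpq) h)
    · exact hpq
  have h1 := mul_pos_of_zero_or hz t.ia hs
  have h2 := mul_pos_of_zero_or hz' t.ia
    (by linarith : 0 < L.f I y' * L.f I z)
  exact false_of_adjacent t.ik t.eik t.ha (mem t.ha t.hb hq) (mem t.ha t'.hb hq')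
    (mem t.ha t.hc hz) (mem t.ha t'.hc hz') (ne t.ne_ab hq) (ne t.swap.ne_ab hz) t.ia t.ka
    (zero t.ia t.ib hq) (zero t.ka t.kc hz) (zero t.ka t'.kc hz') hpq' (by linarith) kq kz kq' kz'
    E E'

variable (L) in
/-- Two lines `A` and `B` crossing at `c` inside the angle at `x` formed by the lines `E` and
`E'`, where `A` meets `E` and `E'` in `a` and `a₂`, and `B` meets them in `b` and `b₂`. -/
structure IsCrossing (E E' A B : ι) (x a b a₂ b₂ c : Pt) : Prop where
  hx : x ∈ L.T
  hb : b ∈ L.T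
  ha₂ : a₂ ∈ L.T
  Ex : L.f E x = 0
  Eb : L.f E b = 0
  Ex' : L.f E' x = 0
  Ea₂ : L.f E' a₂ = 0
  Aa : L.f A a = 0
  Aa₂ : L.f A a₂ = 0
  Bb : L.f B b = 0
  Bb₂ : L.f B b₂ = 0
  hE : E ≠ E'
  eA : ¬ L.edge A
  eB : ¬ L.edge B
  xb : x ≠ b
  xa₂ : x ≠ a₂
  ao : a ∈ openSegment ℝ x b
  bo : b₂ ∈ openSegment ℝ x a₂
  cA : c ∈ openSegment ℝ a a₂
  cB : c ∈ openSegment ℝ b b₂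

namespace IsCrossing

variable {E E' A B : ι} {x a b a₂ b₂ c : Pt}

theorem symm (X : L.IsCrossing E E' A B x a b a₂ b₂ c) :
    L.IsCrossing E' E B A x b₂ a₂ b a c :=
  ⟨X.hx, X.ha₂, X.hb, X.Ex', X.Ea₂, X.Ex, X.Eb, X.Bb₂, X.Bb, X.Aa₂, X.Aa, X.hE.symm, X.eB, X.eA,
    X.xa₂, X.xb, X.bo, X.ao, mem_openSegment_swap X.cB, mem_openSegment_swap X.cA⟩

theorem ha (X : L.IsCrossing E E' A B x a b a₂ b₂ c) :
    a ∈ L.T := mem_of_openSegment X.hx X.hb X.ao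

theorem Ea (X : L.IsCrossing E E' A B x a b a₂ b₂ c) : L.f E a = 0 := zero_of_zero X.ao X.Ex X.Eb

theorem ne_xa (X : L.IsCrossing E E' A B x a b a₂ b₂ c) :
    x ≠ a := (ne_of_mem_openSegment X.xb X.ao).symm

theorem ne_ab (X : L.IsCrossing E E' A B x a b a₂ b₂ c) :
    a ≠ b := ne_of_mem_openSegment X.xb.symm (mem_openSegment_swap X.ao)

theorem ne_EA (X : L.IsCrossing E E' A B x a b a₂ b₂ c) : E ≠ A := by
  rintro rfl
  exact X.xa₂ (eq_of_zero X.hE X.hx X.ha₂ X.Ex X.Aa₂ X.Ex' X.Ea₂)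

theorem ne_EA' (X : L.IsCrossing E E' A B x a b a₂ b₂ c) : E' ≠ A := by
  rintro rfl
  exact X.ne_xa (eq_of_zero X.hE X.hx X.ha X.Ex X.Ea X.Ex' X.Aa)

theorem ne_EB (X : L.IsCrossing E E' A B x a b a₂ b₂ c) : E ≠ B := X.symm.ne_EA'

theorem ne_AB (X : L.IsCrossing E E' A B x a b a₂ b₂ c) : A ≠ B := by
  rintro rfl
  exact X.ne_ab (eq_of_zero X.ne_EA X.ha X.hb X.Ea X.Eb X.Aa X.Bb)

theorem hc (X : L.IsCrossing E E' A B x a b a₂ b₂ c) :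
    c ∈ L.T := mem_of_openSegment X.ha X.ha₂ X.cA

theorem Ac (X : L.IsCrossing E E' A B x a b a₂ b₂ c) : L.f A c = 0 := zero_of_zero X.cA X.Aa X.Aa₂

theorem Bc (X : L.IsCrossing E E' A B x a b a₂ b₂ c) : L.f B c = 0 := X.symm.Ac

theorem ne_ca (X : L.IsCrossing E E' A B x a b a₂ b₂ c) : c ≠ a := by
  rintro rfl
  exact X.ne_ab (eq_of_zero X.ne_EB X.ha X.hb X.Ea X.Eb X.Bc X.Bb)

theorem isTriangle (X : L.IsCrossing E E' A B x a b a₂ b₂ c) : L.IsTriangle A E B c a b :=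
  ⟨X.hc, X.ha, X.hb, X.Ac, X.Aa, X.Ea, X.Eb, X.Bc, X.Bb, X.ne_EA.symm, X.ne_AB, X.ne_EB,
    fun h => X.eA h.1, fun h => X.eA h.1, fun h => X.eB h.2⟩

theorem corner_unsep [Finite ι] (X : L.IsCrossing E E' A B x a b a₂ b₂ c)
    (hS : L.StrongStep) :
    L.Unsep c a ∧ L.Unsep a b := by
  obtain ⟨m, y, y', hy, hy', my, my', E1, -, E3⟩ := X.isTriangle.cornerCell hS
  have hcb : c ≠ b := X.isTriangle.swap.ne_ab
  have By' : L.f B y' = 0 := by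
    rcases hy' with h | rfl
    · exact zero_of_zero h X.Bc X.Bb
    · exact X.Bb
  have hy'T : y' ∈ L.T := by
    rcases hy' with h | rfl
    · exact mem_of_openSegment X.hc X.hb h
    · exact X.hb
  have hy'c : y' ≠ c := by
    rcases hy' with h | rfl
    · exact ne_of_mem_openSegment hcb h
    · exact hcb.symm
  have hmA : m ≠ A := by
    rintro rfl
    exact hy'c (eq_of_zero X.ne_AB hy'T X.hc my' X.Ac By' X.Bc)
  rcases hy with hy | rfl
  · exfalso
    have hyT := mem_of_openSegment X.hc X.ha hy
    have Ay := zero_of_zero hy X.Ac X.Aa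
    have hyc : y ≠ c := ne_of_mem_openSegment X.ne_ca hy
    have hya : y ≠ a := ne_of_mem_openSegment X.ne_ca.symm (mem_openSegment_swap hy)
    have hmB : m ≠ B := by
      rintro rfl
      exact hyc (eq_of_zero X.ne_AB hyT X.hc Ay X.Ac my X.Bc)
    have hmE : m ≠ E := by
      rintro rfl
      exact hya (eq_of_zero X.ne_EA hyT X.ha my X.Ea Ay X.Aa)
    have mc0 : L.f m c ≠ 0 := fun h0 => hyc (eq_of_zero hmA hyT X.hc my h0 Ay X.Ac)
    have mca := mul_neg_of_zero_between hy my mc0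
    replace hy' : y' ∈ openSegment ℝ c b := by
      rcases hy' with h | rfl
      · exact h
      · rcases eq_or_eq X.ne_EB X.hb X.Eb X.Bb my' with h | h
        · exact absurd h hmE
        · exact absurd h hmB
    have mcb := mul_neg_of_zero_between hy' my' mc0
    have ma₂ : L.f m a * L.f m a₂ < 0 := mul_neg_extend X.cA (by linarith)
    have mb₂ : L.f m b * L.f m b₂ < 0 := mul_neg_extend X.cB (by linarith)
    have em := not_edge_of_mul_neg X.hc X.ha mca
    have mx0 : L.f m x ≠ 0 := fun h0 => by
      rcases eq_or_eq X.hE X.hx X.Ex X.Ex' h0 with h | h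
      · exact hmE h
      · simp [h, X.Ea₂] at ma₂
    have hmE' : m ≠ E' := by rintro rfl; exact mx0 X.Ex'
    rcases lt_or_gt_of_ne (mul_ne_zero mx0 mc0) with h | h
    · have h1 := mul_pos_of_mul_neg (by linarith : L.f m c * L.f m b < 0)
        (by linarith : L.f m b₂ * L.f m b < 0)
      have h2 := mul_neg_of_mul_pos_of_mul_neg h1 (by linarith : L.f m c * L.f m x < 0)
      obtain ⟨z, hz, mz⟩ := exists_zero_of_mul_neg (by linarith : L.f m x * L.f m b₂ < 0)
      have hzT := mem_of_openSegment X.hx X.symm.ha hz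
      have hbo : b₂ ∈ openSegment ℝ z a₂ := mem_openSegment_swap
        (mem_openSegment_of_mem (mem_openSegment_swap X.bo) (mem_openSegment_swap hz))
      have hb0 : L.f E' b ≠ 0 := fun h0 => X.xb (eq_of_zero X.hE X.hx X.hb X.Ex X.Eb X.Ex' h0)
      have hy'o : y' ∈ openSegment ℝ b₂ b := mem_openSegment_swap
        (mem_openSegment_shrink X.cB (mem_openSegment_swap hy'))
      have s1 := mul_pos_of_zero_left hy'o X.symm.Ea hb0
      have s2 := mul_pos_of_zero_left (mem_openSegment_swap X.cB) X.symm.Ea hb0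
      refine false_of_two_triangles hS (I := E') (J := B) (m := m) (n := A) (p := b₂) (x := z)
        (x' := a₂) (y := y') (y' := c)
        ⟨X.symm.ha, hzT, hy'T, X.symm.Ea, zero_of_zero hz X.Ex' X.symm.Ea, mz, my', X.Bb₂, By',
          hmE'.symm, X.symm.ne_EA, hmB, fun h => em h.2, fun h => X.eB h.2, fun h => em h.1⟩
        ⟨X.symm.ha, X.ha₂, X.hc, X.symm.Ea, X.Ea₂, X.Aa₂, X.Ac, X.Bb₂, X.Bc, X.ne_EA',
          X.symm.ne_EA, X.ne_AB, fun h => X.eA h.2, fun h => X.eB h.2, fun h => X.eA h.1⟩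
        hbo (mul_pos_of_mul_pos_right s1 s2)
    · have h2 := mul_neg_of_mul_pos_of_mul_neg (by linarith : 0 < L.f m c * L.f m x) mca
      obtain ⟨z, hz, mz⟩ := exists_zero_of_mul_neg h2
      have hzT := mem_of_openSegment X.hx X.ha hz
      have hao : a ∈ openSegment ℝ z b := mem_openSegment_swap
        (mem_openSegment_of_mem (mem_openSegment_swap X.ao) (mem_openSegment_swap hz))
      have hc0 : L.f E c ≠ 0 := fun h0 =>
        X.ne_ca (eq_of_zero X.ne_EA X.hc X.ha h0 X.Ea X.Ac X.Aa)
      exact false_of_two_triangles hS (I := E) (J := A) (m := m) (n := B) (p := a) (x := z)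
        (x' := b) (y := y) (y' := c)
        ⟨X.ha, hzT, hyT, X.Ea, zero_of_zero hz X.Ex X.Ea, mz, my, X.Aa, Ay,
          hmE.symm, X.ne_EA, hmA, fun h => em h.2, fun h => X.eA h.2, fun h => em h.1⟩
        ⟨X.ha, X.hb, X.hc, X.Ea, X.Eb, X.Bb, X.Bc, X.Aa, X.Ac, X.ne_EB,
          X.ne_EA, X.ne_AB.symm, fun h => X.eB h.2, fun h => X.eA h.2, fun h => X.eB h.1⟩
        hao (mul_pos_of_zero_left (mem_openSegment_swap hy) X.Ea hc0)
  · refine ⟨E1, ?_⟩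
    have hmE : m = E := (eq_or_eq X.ne_EA X.ha X.Ea X.Aa my).resolve_right hmA
    subst hmE
    have := eq_of_zero X.ne_EB hy'T X.hb my' X.Eb By' X.Bb
    rwa [this] at E3

/-- No further line crosses the open segment `a c`. -/
theorem eq_of_mem_openSegment [Finite ι] (X : L.IsCrossing E E' A B x a b a₂ b₂ c)
    (hS : L.StrongStep) {s : ι} {p : Pt}
    (hp : p ∈ openSegment ℝ a c) (sp : L.f s p = 0) : s = A := by
  by_contra hs
  have hpa : p ≠ a := ne_of_mem_openSegment X.ne_ca.symm hp
  have sa : L.f s a ≠ 0 := fun h0 => hpa (eq_of_zero hs (mem_of_openSegment X.ha X.hc hp) X.ha sp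
    h0 (zero_of_zero hp X.Aa X.Ac) X.Aa)
  exact absurd ((X.corner_unsep hS).1.symm s) (not_le.mpr (mul_neg_of_zero_between hp sp sa))

theorem not_block_sep [Finite ι] (X : L.IsCrossing E E' A B x a b a₂ b₂ c)
    (hS : L.StrongStep) {k : κ} (hk : L.h k c = 0) :
    ¬ L.h k x * L.h k a < 0 := fun h => by
  obtain ⟨g, hg, kg⟩ := exists_zero_of_mul_neg h
  obtain ⟨E1, E2⟩ := X.corner_unsep hS
  have kb := L.block_sep B k c b X.hc X.hb X.isTriangle.swap.ne_ab X.Bc X.Bb hk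
  have ka : L.h k a ≠ 0 := right_ne_zero_of_mul h.ne
  have h1 := mul_neg_of_zero_between X.cB hk kb
  have h2 : 0 < L.h k b * L.h k a := by
    have := block_unsep X.ha X.hb X.Ea X.Eb E2 k
    rw [mul_comm]
    exact lt_of_le_of_ne this (mul_ne_zero ka kb).symm
  have h3 := mul_neg_of_mul_pos_of_mul_neg h2 h1
  have hgT := mem_of_openSegment X.hx X.ha hg
  have Eg := zero_of_zero hg X.Ex X.Ea
  have Eg' := hS k E A B E' a c b₂ g X.ha X.hc X.symm.ha hgT X.Ea X.Aa X.Ac X.Bc X.Bb₂ X.symm.Ea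
    X.ne_EA X.ne_AB X.symm.ne_EA.symm X.ne_ca.symm X.symm.ne_ca.symm E1 (X.symm.corner_unsep hS).1
    hk h3 kg Eg
  exact ne_of_mem_openSegment X.ne_xa hg (eq_of_zero X.hE hgT X.hx Eg X.Ex Eg' X.Ex')

/-- The blocking line through `c` passes through `x`. -/
theorem block_zero [Finite ι] (X : L.IsCrossing E E' A B x a b a₂ b₂ c)
    (hS : L.StrongStep) {k : κ} (hk : L.h k c = 0) : L.h k x = 0 := by
  by_contra kx
  have kb := L.block_sep B k c b X.hc X.hb X.isTriangle.swap.ne_ab X.Bc X.Bb hk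
  have ka := L.block_sep A k c a X.hc X.ha X.ne_ca X.Ac X.Aa hk
  have kb₂ := L.block_sep B k c b₂ X.hc X.symm.ha X.symm.ne_ca X.Bc X.Bb₂ hk
  have h1 := mul_neg_of_zero_between X.cB hk kb
  have h2 := not_lt.mp (X.not_block_sep hS hk)
  have h3 := not_lt.mp (X.symm.not_block_sep hS hk)
  have h4 := block_unsep X.ha X.hb X.Ea X.Eb (X.corner_unsep hS).2 k
  have h5 : 0 < L.h k x * L.h k a := lt_of_le_of_ne h2 (mul_ne_zero kx ka).symm
  have h6 : 0 < L.h k b * L.h k a :=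
    lt_of_le_of_ne (by linarith) (mul_ne_zero kb ka).symm
  have h7 := mul_neg_of_mul_pos_of_mul_neg (mul_pos_of_mul_pos_right h6 h5) h1
  exact absurd h3 (not_le.mpr h7)

end IsCrossing

/-! ### Cells -/

variable (L) in
/-- The closed cell of the point `p`. -/
def cell (p : Pt) : Set Pt := {x | ∀ i, 0 ≤ L.f i x * L.f i p}

variable (L) in
/-- The line `i` contains the side `u v` of the cell of `p`. -/
structure IsSide (p : Pt) (i : ι) (u v : Pt) : Prop where
  ne : u ≠ v
  left : u ∈ L.cell p
  right : v ∈ L.cell p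
  zero_left : L.f i u = 0
  zero_right : L.f i v = 0

variable (L) in
/-- Condition (A) in terms of the line system. -/
def CellStrong : Prop := ∀ (p : Pt) (k : κ) (i₀₁ i₁₂ i₂₃ i₃₄ i₄₅ i₅₆ : ι)
  (v₀ v₁ v₂ v₃ v₄ v₅ v₆ g : Pt), p ∈ L.T → (∀ i, L.f i p ≠ 0) →
  L.IsSide p i₀₁ v₀ v₁ → L.IsSide p i₁₂ v₁ v₂ → L.IsSide p i₂₃ v₂ v₃ → L.IsSide p i₃₄ v₃ v₄ →
  L.IsSide p i₄₅ v₄ v₅ → L.IsSide p i₅₆ v₅ v₆ → i₀₁ ≠ i₁₂ → i₁₂ ≠ i₂₃ → i₂₃ ≠ i₃₄ → i₃₄ ≠ i₄₅ →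
  i₄₅ ≠ i₅₆ → List.Pairwise (· ≠ ·) [v₁, v₂, v₃, v₄, v₅] → L.h k v₃ = 0 → L.h k p = 0 →
  g ∈ L.T → L.f i₁₂ g = 0 → L.h k g = 0 → L.f i₄₅ g = 0

theorem mem_T_of_cell {p x : Pt} (hp : p ∈ L.T) (hp0 : ∀ i, L.f i p ≠ 0) (hx : x ∈ L.cell p) :
    x ∈ L.T := by
  rw [L.mem_T] at *
  intro e he
  exact nonneg_of_mul_nonneg_left (hx e) (lt_of_le_of_ne (hp e he) (hp0 e).symm)

theorem mul_nonneg_of_mul_nonneg {a b c : ℝ} (hc : c ≠ 0) (h1 : 0 ≤ a * c) (h2 : 0 ≤ b * c) :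
    0 ≤ a * b := by
  have h3 := mul_nonneg h1 h2
  have h4 : a * c * (b * c) = a * b * c ^ 2 := by ring
  rw [h4] at h3
  exact nonneg_of_mul_nonneg_left h3 (by positivity)

theorem unsep_of_cell {p x y : Pt} (hp0 : ∀ i, L.f i p ≠ 0) (hx : x ∈ L.cell p)
    (hy : y ∈ L.cell p) : L.Unsep x y := fun i =>
  mul_nonneg_of_mul_nonneg (hp0 i) (hx i) (hy i)

/-- The vertex of a cell following `v` along the line `i`. -/
theorem exists_isSide [Finite ι] {p v : Pt} {i j : ι} (hp : p ∈ L.T) (hp0 : ∀ i, L.f i p ≠ 0)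
    (hv : v ∈ L.cell p) (hij : i ≠ j) (hi : L.f i v = 0) (hj : L.f j v = 0) :
    ∃ w, L.IsSide p i v w ∧ ∃ k, k ≠ i ∧ L.f k w = 0 := by
  have hvT := mem_T_of_cell hp hp0 hv
  obtain ⟨x, hx, y, hy, hxy, ix, iy⟩ := L.two i
  have hlin : ∀ k, (L.f k).linear (y - x) = L.f k y - L.f k x := fun k => by
    have := (L.f k).linearMap_vsub y x
    simpa only [vsub_eq_sub] using this
  have hj0 : (L.f j).linear (y - x) ≠ 0 := by
    intro h0
    rw [hlin, sub_eq_zero] at h0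
    obtain ⟨t, rfl⟩ := L.coll i x y v ix iy hi hxy
    rw [AffineMap.apply_lineMap, h0, AffineMap.lineMap_same_apply] at hj
    exact hij (L.inj i j x y hx hy hxy ix iy hj (h0.trans hj))
  obtain ⟨d, hd0, hdi, hdj⟩ : ∃ d : Pt, d ≠ 0 ∧ (L.f i).linear d = 0 ∧
      0 < (L.f j).linear d * L.f j p := by
    rcases lt_or_gt_of_ne (mul_ne_zero hj0 (hp0 j)) with h | h
    · refine ⟨-(y - x), neg_ne_zero.mpr (sub_ne_zero.mpr hxy.symm), ?_, ?_⟩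
      · rw [map_neg, hlin, ix, iy]; simp
      · rw [map_neg]; linarith
    · exact ⟨y - x, sub_ne_zero.mpr hxy.symm, by rw [hlin, ix, iy, sub_zero], h⟩
  obtain ⟨t, ht, -, h0, hE, k, hk, hk0⟩ := exists_ray hvT hi hd0 hdi fun e he h0 => by
    rcases eq_or_eq hij hvT hi hj h0 with rfl | rfl
    · rw [hdi]
    · exact (pos_of_mul_pos_left hdj ((L.mem_T p).mp hp e he)).le
  refine ⟨_, ⟨?_, hv, fun n => ?_, hi, h0⟩, k, hk, hk0⟩
  · intro h
    have : t • d = 0 := by simpa using h.symm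
    rcases smul_eq_zero.mp this with h | h
    · exact ht.ne' h
    · exact hd0 h
  · by_cases hn : L.f n v = 0
    · rcases eq_or_eq hij hvT hi hj hn with rfl | rfl
      · rw [h0, zero_mul]
      · have := (L.f n).map_vadd v (t • d)
        simp only [vadd_eq_add, map_smul, smul_eq_mul] at this
        rw [add_comm v, this, hn, add_zero, mul_assoc]
        exact (mul_pos ht hdj).le
    · exact mul_nonneg_of_mul_nonneg hn (by rw [mul_comm]; exact hE n) (by
        rw [mul_comm]; exact hv n)

theorem strongStep_of_cellStrong [Finite ι] (hS : L.CellStrong) : L.StrongStep := by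
  intro k i₁₂ i₂₃ i₃₄ i₄₅ v₂ v₃ v₄ g hv₂ hv₃ hv₄ hg a1 a2 a3 a4 a5 a6 n1 n2 n3 h23 h43 E1 E2 k3 k24
    kg fg
  obtain ⟨d, hd, kd⟩ := exists_zero_of_mul_neg k24
  obtain ⟨p, hpo, hpi⟩ : ∃ p ∈ openSegment ℝ v₃ d, ∀ i, L.f i v₃ ≠ 0 →
      0 < L.f i v₃ * L.f i p := by
    have h1 : ∀ᶠ t : ℝ in nhdsWithin 0 (Ioi 0), ∀ i, L.f i v₃ ≠ 0 →
        0 < L.f i v₃ * L.f i (AffineMap.lineMap v₃ d t) := by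
      rw [Filter.eventually_all]
      intro i
      by_cases h0 : L.f i v₃ = 0
      · simp [h0]
      refine Filter.Eventually.mono (eventually_nhdsWithin_of_eventually_nhds ?_) fun _ h _ => h
      have hc : ContinuousAt (fun t : ℝ => L.f i v₃ * L.f i (AffineMap.lineMap v₃ d t)) 0 := by
        simp only [AffineMap.apply_lineMap, AffineMap.lineMap_apply_ring']
        fun_prop
      refine hc.eventually (lt_mem_nhds ?_)
      beta_reduce
      rw [AffineMap.lineMap_apply_zero]
      exact mul_self_pos.mpr h0
    obtain ⟨t, ht, ht0, ht1⟩ :=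
      (h1.and (Ioo_mem_nhdsGT (show (0 : ℝ) < 1 from one_pos))).exists
    refine ⟨_, ?_, ht⟩
    rw [openSegment_eq_image_lineMap]
    exact ⟨t, ⟨ht0, ht1⟩, rfl⟩
  have hpT := mem_of_openSegment hv₃ (mem_of_openSegment hv₂ hv₄ hd) hpo
  have b1 : 0 < L.f i₂₃ p * L.f i₂₃ v₄ := by
    have h0 : L.f i₂₃ v₄ ≠ 0 := fun h0 => h43 (eq_of_zero n2 hv₄ hv₃ h0 a3 a5 a4)
    exact mul_pos_of_zero_or (Or.inl hpo) a3 (mul_pos_of_zero_left hd a2 h0)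
  have b2 : 0 < L.f i₃₄ p * L.f i₃₄ v₂ := by
    have h0 : L.f i₃₄ v₂ ≠ 0 := fun h0 => h23 (eq_of_zero n2 hv₂ hv₃ a2 a3 h0 a4)
    exact mul_pos_of_zero_or (Or.inl hpo) a4
      (mul_pos_of_zero_left (mem_openSegment_swap hd) a5 h0)
  have hp0 : ∀ i, L.f i p ≠ 0 := fun i h0 => by
    by_cases h3 : L.f i v₃ = 0
    · rcases eq_or_eq n2 hv₃ a3 a4 h3 with rfl | rfl
      · simp [h0] at b1
      · simp [h0] at b2
    · have := hpi i h3
      simp [h0] at this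
  have c3 : v₃ ∈ L.cell p := fun i => by
    by_cases h3 : L.f i v₃ = 0
    · simp [h3]
    · exact (hpi i h3).le
  have c2 : v₂ ∈ L.cell p := fun i => by
    by_cases h3 : L.f i v₃ = 0
    · rcases eq_or_eq n2 hv₃ a3 a4 h3 with rfl | rfl
      · simp [a2]
      · linarith
    · exact mul_nonneg_of_mul_nonneg h3 (by rw [mul_comm]; exact E1 i)
        (by rw [mul_comm]; exact (hpi i h3).le)
  have c4 : v₄ ∈ L.cell p := fun i => by
    by_cases h3 : L.f i v₃ = 0
    · rcases eq_or_eq n2 hv₃ a3 a4 h3 with rfl | rfl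
      · linarith
      · simp [a5]
    · exact mul_nonneg_of_mul_nonneg h3 (by rw [mul_comm]; exact E2 i)
        (by rw [mul_comm]; exact (hpi i h3).le)
  obtain ⟨v₁, s12, i₀₁, n01, z01⟩ := exists_isSide hpT hp0 c2 n1 a1 a2
  obtain ⟨v₅, s45, i₅₆, n56, z56⟩ := exists_isSide hpT hp0 c4 n3.symm a6 a5
  obtain ⟨v₀, s01, -⟩ := exists_isSide hpT hp0 s12.right n01 z01 s12.zero_right
  obtain ⟨v₆, s56, -⟩ := exists_isSide hpT hp0 s45.right n56 z56 s45.zero_right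
  have hv₁ := mem_T_of_cell hpT hp0 s12.right
  have hv₅ := mem_T_of_cell hpT hp0 s45.right
  have E24 := unsep_of_cell hp0 c2 c4
  by_cases h15 : v₁ = v₅
  · subst h15
    have e1 := block_unsep hv₂ hv₁ a1 s12.zero_right (unsep_of_cell hp0 c2 s12.right) k
    have e2 := block_unsep hv₄ hv₁ a6 s45.zero_right (unsep_of_cell hp0 c4 s12.right) k
    have k1 : L.h k v₁ = 0 := by
      by_contra h0
      exact absurd (mul_nonneg_of_mul_nonneg h0 e1 e2) (not_le.mpr k24)
    by_contra h45
    exact L.block_sep i₁₂ k v₁ g hv₁ hg (by rintro rfl; exact h45 s45.zero_right) s12.zero_right fg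
      k1 kg
  refine hS p k i₀₁ i₁₂ i₂₃ i₃₄ i₄₅ i₅₆ v₀ v₁ v₂ v₃ v₄ v₅ v₆ g hpT hp0
    ⟨s01.ne.symm, s01.right, s01.left, s01.zero_right, s01.zero_left⟩
    ⟨s12.ne.symm, s12.right, s12.left, s12.zero_right, s12.zero_left⟩
    ⟨h23, c2, c3, a2, a3⟩ ⟨h43.symm, c3, c4, a4, a5⟩ s45 s56 n01 n1 n2 n3 n56.symm ?_ k3
    (zero_of_zero hpo k3 kd) hg fg kg
  simp only [List.pairwise_cons, List.mem_cons, List.not_mem_nil, or_false, forall_eq_or_imp,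
    forall_eq, false_imp_iff, implies_true, and_true, List.Pairwise.nil]
  refine ⟨⟨s12.ne.symm, ?_, ?_, h15⟩, ⟨h23, ?_, ?_⟩, ⟨h43.symm, ?_⟩, s45.ne⟩
  · rintro rfl
    exact h23 (eq_of_zero n1 hv₂ hv₁ a1 s12.zero_right a2 a3)
  · rintro rfl
    exact absurd (block_unsep hv₂ hv₁ a1 s12.zero_right E24 k) (not_le.mpr k24)
  · rintro rfl
    exact absurd k24 (not_lt.mpr (mul_self_nonneg _))
  · rintro rfl
    exact absurd (block_unsep hv₂ hv₄ s45.zero_right a6 E24 k) (not_le.mpr k24)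
  · rintro rfl
    exact h43 (eq_of_zero n3 hv₄ hv₅ a5 a4 a6 s45.zero_right)

theorem continuous_f (i : ι) : Continuous (L.f i) := (L.f i).continuous_of_finiteDimensional

theorem isClosed_cell (p : Pt) : IsClosed (L.cell p) := by
  have : L.cell p = ⋂ i, {x | 0 ≤ L.f i x * L.f i p} := by ext; simp [cell]
  rw [this]
  exact isClosed_iInter fun i =>
    isClosed_le continuous_const ((continuous_f i).mul continuous_const)

theorem mem_interior_cell [Finite ι] {p : Pt} (hp0 : ∀ i, L.f i p ≠ 0) :
    p ∈ interior (L.cell p) := by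
  have hopen : IsOpen (⋂ i, {x | 0 < L.f i x * L.f i p}) := isOpen_iInter_of_finite fun i =>
    isOpen_lt continuous_const ((continuous_f i).mul continuous_const)
  refine mem_interior.mpr ⟨_, fun x hx i => ?_, hopen, mem_iInter.mpr fun i => ?_⟩
  · exact (mem_iInter.mp hx i).le
  · exact mul_self_pos.mpr (hp0 i)

theorem mem_frontier_cell {p x : Pt} {i : ι} (hp0 : ∀ i, L.f i p ≠ 0) (hx : x ∈ L.cell p)
    (hi : L.f i x = 0) : x ∈ frontier (L.cell p) := by
  rw [(isClosed_cell p).frontier_eq]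
  refine ⟨hx, fun hint => ?_⟩
  have hc : ContinuousAt (fun t : ℝ => AffineMap.lineMap x p t) (0 : ℝ) := by
    simp only [AffineMap.lineMap_apply_module']; fun_prop
  have h1 : ∀ᶠ t in nhdsWithin (0 : ℝ) (Iio 0), AffineMap.lineMap x p t ∈ L.cell p := by
    refine eventually_nhdsWithin_of_eventually_nhds (hc.eventually ?_)
    beta_reduce
    rw [AffineMap.lineMap_apply_zero]
    exact mem_interior_iff_mem_nhds.mp hint
  obtain ⟨t, ht, ht0⟩ := (h1.and self_mem_nhdsWithin).exists
  have h2 := ht i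
  rw [AffineMap.apply_lineMap, AffineMap.lineMap_apply_ring', hi, sub_zero, add_zero,
    mul_assoc] at h2
  have h3 := mul_neg_of_neg_of_pos (show t < 0 from ht0) (mul_self_pos.mpr (hp0 i))
  exact absurd h2 (not_le.mpr h3)

theorem closure_component [Finite ι] {p : Pt} (hp : p ∈ L.T) (hp0 : ∀ i, L.f i p ≠ 0) :
    closure (connectedComponentIn {x ∈ L.T | ∀ i, L.f i x ≠ 0} p) = L.cell p := by
  set U : Set Pt := {x ∈ L.T | ∀ i, L.f i x ≠ 0} with hU
  have hpU : p ∈ U := ⟨hp, hp0⟩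
  apply subset_antisymm
  · refine closure_minimal (fun x hx i => ?_) (isClosed_cell p)
    by_contra hneg
    have hpre := isPreconnected_connectedComponentIn (F := U) (x := p)
    have hzero : ∃ z ∈ connectedComponentIn U p, L.f i z = 0 := by
      have hpc := mem_connectedComponentIn hpU
      have hcont := (continuous_f (L := L) i).continuousOn (s := connectedComponentIn U p)
      rcases lt_or_gt_of_ne (hp0 i) with h | h
      · have hx0 : 0 ≤ L.f i x := by by_contra h'; nlinarith
        obtain ⟨z, hz, hz0⟩ := hpre.intermediate_value hpc hx hcont ⟨h.le, hx0⟩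
        exact ⟨z, hz, hz0⟩
      · have hx0 : L.f i x ≤ 0 := by by_contra h'; nlinarith
        obtain ⟨z, hz, hz0⟩ := hpre.intermediate_value hx hpc hcont ⟨hx0, h.le⟩
        exact ⟨z, hz, hz0⟩
    obtain ⟨z, hz, hz0⟩ := hzero
    exact (connectedComponentIn_subset U p hz).2 i hz0
  · intro x hx
    have hsub : openSegment ℝ x p ∪ {p} ⊆ connectedComponentIn U p := by
      refine IsPreconnected.subset_connectedComponentIn ?_ (Or.inr rfl) ?_
      · refine IsPreconnected.subset_closure (convex_openSegment x p).isPreconnected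
          subset_union_left ?_
        refine union_subset subset_closure (singleton_subset_iff.mpr ?_)
        exact segment_subset_closure_openSegment (right_mem_segment ℝ x p)
      · rintro z (hz | rfl)
        · refine ⟨mem_of_openSegment (mem_T_of_cell hp hp0 hx) hp hz, fun i h0 => ?_⟩
          obtain ⟨s, t, hs, ht, -, h⟩ := openSegment_affine hz
          have h1 := h (L.f i)
          rw [h0] at h1
          have h2 := mul_pos ht (mul_self_pos.mpr (hp0 i))
          have h3 := mul_nonneg hs.le (hx i)
          have h4 : (s * L.f i x + t * L.f i p) * L.f i p =
              s * (L.f i x * L.f i p) + t * (L.f i p * L.f i p) := by ring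
          rw [← h1, zero_mul] at h4
          linarith
        · exact hpU
    exact closure_mono (subset_union_left.trans hsub)
      (segment_subset_closure_openSegment (left_mem_segment ℝ x p))

theorem convex_cell (p : Pt) : Convex ℝ (L.cell p) := by
  intro x hx y hy s t hs ht hst i
  rw [Convex.combo_affine_apply hst]
  simp only [smul_eq_mul]
  nlinarith [mul_nonneg hs (hx i), mul_nonneg ht (hy i)]

theorem IsSide.segment_subset_frontier {p u v : Pt} {i : ι} (hp0 : ∀ i, L.f i p ≠ 0)
    (S : L.IsSide p i u v) : ∀ z ∈ segment ℝ u v, L.f i z = 0 ∧ z ∈ frontier (L.cell p) := by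
  intro z hz
  have hz0 : L.f i z = 0 := by
    obtain ⟨s, t, -, -, hst, rfl⟩ := hz
    rw [Convex.combo_affine_apply hst, S.zero_left, S.zero_right]; simp
  exact ⟨hz0, mem_frontier_cell hp0 ((convex_cell p).segment_subset S.left S.right hz) hz0⟩

end LineSystem

/-! ### The functionals of a triangle blocking arrangement -/

/-- The signed area functional of the line through `a` and `b`. -/
def cr (a b : Pt) : Pt →ᵃ[ℝ] ℝ :=
  ((b.1 - a.1) • LinearMap.snd ℝ ℝ ℝ - (b.2 - a.2) • LinearMap.fst ℝ ℝ ℝ).toAffineMap +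
    AffineMap.const ℝ Pt ((b.2 - a.2) * a.1 - (b.1 - a.1) * a.2)

theorem cr_apply (a b p : Pt) :
    cr a b p = (b.1 - a.1) * (p.2 - a.2) - (b.2 - a.2) * (p.1 - a.1) := by
  simp [cr]; ring

theorem exists_lineMap_of_cr {a b z : Pt} (hab : a ≠ b) (hz : cr a b z = 0) :
    ∃ t : ℝ, z = AffineMap.lineMap a b t := by
  rw [cr_apply] at hz
  by_cases h1 : b.1 - a.1 = 0
  · have h2 : b.2 - a.2 ≠ 0 := fun h2 => hab (Prod.ext (by linarith) (by linarith))
    have h3 : z.1 - a.1 = 0 := by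
      rw [h1, zero_mul, zero_sub, neg_eq_zero] at hz
      exact (mul_eq_zero.mp hz).resolve_left h2
    refine ⟨(z.2 - a.2) / (b.2 - a.2), Prod.ext ?_ ?_⟩
    · simp [AffineMap.lineMap_apply, h1]; linarith
    · simp [AffineMap.lineMap_apply, h2]
  · refine ⟨(z.1 - a.1) / (b.1 - a.1), Prod.ext ?_ ?_⟩
    · simp [AffineMap.lineMap_apply, h1]
    · simp [AffineMap.lineMap_apply]; field_simp; linarith

theorem exists_lineMap_of_cr_of_cr {a b x y z : Pt} (hab : a ≠ b) (hx : cr a b x = 0)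
    (hy : cr a b y = 0) (hz : cr a b z = 0) (hxy : x ≠ y) :
    ∃ t : ℝ, z = AffineMap.lineMap x y t := by
  obtain ⟨r, rfl⟩ := exists_lineMap_of_cr hab hx
  obtain ⟨s, rfl⟩ := exists_lineMap_of_cr hab hy
  obtain ⟨t, rfl⟩ := exists_lineMap_of_cr hab hz
  have hrs : s - r ≠ 0 := fun h => hxy (by rw [sub_eq_zero.mp h])
  refine ⟨(t - r) / (s - r), ?_⟩
  simp only [AffineMap.lineMap_apply_module']
  rw [show s • (b - a) + a - (r • (b - a) + a) = (s - r) • (b - a) by module, smul_smul,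
    div_mul_cancel₀ _ hrs]
  module

theorem cr_of_mem_segment {a b z : Pt} (hz : z ∈ segment ℝ a b) : cr a b z = 0 := by
  obtain ⟨s, t, -, -, hst, rfl⟩ := hz
  rw [Convex.combo_affine_apply hst]
  simp [cr_apply]; right; ring

/-- The barycentric coordinate with respect to the triangle `x y z` that is one at `z`. -/
def coord (x y z : Pt) : Pt →ᵃ[ℝ] ℝ := (cr x y z)⁻¹ • cr x y

theorem coord_apply (x y z p : Pt) : coord x y z p = (cr x y z)⁻¹ * cr x y p := rfl

theorem cr_rotate (x y z : Pt) : cr y z x = cr x y z := by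
  simp only [cr_apply]; ring

theorem coord_zero_of_mem {x y z p : Pt} (hp : p ∈ segment ℝ x y) : coord x y z p = 0 := by
  rw [coord_apply, cr_of_mem_segment hp, mul_zero]

theorem coord_self {x y z : Pt} (h : cr x y z ≠ 0) : coord x y z z = 1 := by
  rw [coord_apply, inv_mul_cancel₀ h]

theorem coord_sum {x y z : Pt} (h : cr x y z ≠ 0) (p : Pt) :
    coord y z x p + coord z x y p + coord x y z p = 1 := by
  simp only [coord_apply, cr_rotate, cr_rotate y z x]
  rw [← mul_add, ← mul_add, inv_mul_eq_one₀ h]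
  simp only [cr_apply]; ring

theorem eq_coord_combo {x y z : Pt} (h : cr x y z ≠ 0) (p : Pt) :
    p = coord y z x p • x + coord z x y p • y + coord x y z p • z := by
  simp only [coord_apply, cr_rotate, cr_rotate y z x]
  simp only [mul_smul, ← smul_add]
  rw [eq_inv_smul_iff₀ h]
  ext <;> simp [cr_apply] <;> ring

theorem mem_segment_of_coord {x y z p : Pt} (h : cr x y z ≠ 0) (h1 : coord x y z p = 0)
    (h2 : 0 ≤ coord y z x p) (h3 : 0 ≤ coord z x y p) : p ∈ segment ℝ x y := by
  refine ⟨_, _, h2, h3, ?_, ?_⟩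
  · have := coord_sum h p
    linarith
  · have := eq_coord_combo h p
    rw [h1, zero_smul, add_zero] at this
    exact this.symm

theorem mem_convexHull_iff_coord {x y z : Pt} (h : cr x y z ≠ 0) (p : Pt) :
    p ∈ convexHull ℝ {x, y, z} ↔
      0 ≤ coord x y z p ∧ 0 ≤ coord y z x p ∧ 0 ≤ coord z x y p := by
  have h' : cr y z x ≠ 0 := by rwa [cr_rotate]
  have h'' : cr z x y ≠ 0 := by rwa [cr_rotate]
  constructor
  · intro hp
    have hconv : Convex ℝ {q : Pt | 0 ≤ coord x y z q ∧ 0 ≤ coord y z x q ∧ 0 ≤ coord z x y q} :=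
      ((convex_Ici (0 : ℝ)).affine_preimage (coord x y z)).inter
        (((convex_Ici (0 : ℝ)).affine_preimage (coord y z x)).inter
          ((convex_Ici (0 : ℝ)).affine_preimage (coord z x y)))
    refine convexHull_min ?_ hconv hp
    rintro q (rfl | rfl | rfl)
    · simp [coord_self h', coord_zero_of_mem (left_mem_segment ℝ _ _),
        coord_zero_of_mem (right_mem_segment ℝ _ _)]
    · simp [coord_self h'', coord_zero_of_mem (left_mem_segment ℝ _ _),
        coord_zero_of_mem (right_mem_segment ℝ _ _)]
    · simp [coord_self h, coord_zero_of_mem (left_mem_segment ℝ _ _),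
        coord_zero_of_mem (right_mem_segment ℝ _ _)]
  · rintro ⟨h1, h2, h3⟩
    refine mem_convexHull_of_exists_fintype
      ![coord y z x p, coord z x y p, coord x y z p] ![x, y, z] ?_ ?_ ?_ ?_
    · intro i; fin_cases i <;> simpa
    · simpa [Fin.sum_univ_three] using coord_sum h p
    · intro i; fin_cases i <;> simp
    · simpa [Fin.sum_univ_three] using (eq_coord_combo h p).symm

namespace TBA

variable {Δ : TBA}

theorem cr_ne_zero : cr Δ.x1 Δ.x2 Δ.x3 ≠ 0 := by
  intro h
  have hi := Δ.indep
  have h12 : Δ.x1 ≠ Δ.x2 := fun h => by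
    have := hi.injective (a₁ := 0) (a₂ := 1) (by simpa using h)
    simp at this
  obtain ⟨t, ht⟩ := exists_lineMap_of_cr h12 h
  rw [affineIndependent_iff_not_collinear_set] at hi
  apply hi
  have hset : ({Δ.x1, Δ.x2, Δ.x3} : Set Pt) = {Δ.x3, Δ.x1, Δ.x2} := by
    ext; simp only [mem_insert_iff, mem_singleton_iff]; tauto
  rw [hset]
  refine collinear_insert_of_mem_affineSpan_pair ?_
  rw [ht]
  exact AffineMap.lineMap_mem_affineSpan_pair t Δ.x1 Δ.x2

theorem mem_tri (p : Pt) : p ∈ Δ.tri ↔ 0 ≤ coord Δ.x1 Δ.x2 Δ.x3 p ∧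
    0 ≤ coord Δ.x2 Δ.x3 Δ.x1 p ∧ 0 ≤ coord Δ.x3 Δ.x1 Δ.x2 p :=
  mem_convexHull_iff_coord cr_ne_zero p

theorem convex_tri : Convex ℝ Δ.tri := convex_convexHull ℝ _

theorem x1_mem_tri : Δ.x1 ∈ Δ.tri := subset_convexHull ℝ _ (by simp)

theorem x2_mem_tri : Δ.x2 ∈ Δ.tri := subset_convexHull ℝ _ (by simp)

theorem x3_mem_tri : Δ.x3 ∈ Δ.tri := subset_convexHull ℝ _ (by simp)

theorem bdry_subset_tri : Δ.bdry ⊆ Δ.tri :=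
  union_subset (union_subset (convex_tri.segment_subset x1_mem_tri x2_mem_tri)
    (convex_tri.segment_subset x2_mem_tri x3_mem_tri))
    (convex_tri.segment_subset x3_mem_tri x1_mem_tri)

theorem mem_edge₁₂ {p : Pt} (hp : p ∈ Δ.tri) (h : coord Δ.x1 Δ.x2 Δ.x3 p = 0) :
    p ∈ segment ℝ Δ.x1 Δ.x2 :=
  mem_segment_of_coord cr_ne_zero h ((mem_tri p).mp hp).2.1 ((mem_tri p).mp hp).2.2

theorem mem_edge₂₃ {p : Pt} (hp : p ∈ Δ.tri) (h : coord Δ.x2 Δ.x3 Δ.x1 p = 0) :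
    p ∈ segment ℝ Δ.x2 Δ.x3 :=
  mem_segment_of_coord (by rw [cr_rotate]; exact cr_ne_zero) h ((mem_tri p).mp hp).2.2
    ((mem_tri p).mp hp).1

theorem mem_edge₃₁ {p : Pt} (hp : p ∈ Δ.tri) (h : coord Δ.x3 Δ.x1 Δ.x2 p = 0) :
    p ∈ segment ℝ Δ.x3 Δ.x1 :=
  mem_segment_of_coord (by rw [cr_rotate, cr_rotate]; exact cr_ne_zero) h ((mem_tri p).mp hp).1
    ((mem_tri p).mp hp).2.1

theorem zero_of_nonneg {φ : Pt →ᵃ[ℝ] ℝ} {x y z : Pt} (hz : z ∈ openSegment ℝ x y)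
    (h0 : φ z = 0) (hx : 0 ≤ φ x) (hy : 0 ≤ φ y) : φ x = 0 := by
  by_contra h
  exact absurd (mul_neg_of_zero_between hz h0 h) (not_lt.mpr (mul_nonneg hx hy))

theorem openSegment_subset_bdry {a b p : Pt} (ha : a ∈ Δ.tri) (hp : p ∈ Δ.tri)
    (hb : b ∈ Δ.bdry) (hbo : b ∈ openSegment ℝ a p) : openSegment ℝ a b ⊆ Δ.bdry := by
  intro m hm
  have hmT := convex_tri.openSegment_subset ha (bdry_subset_tri hb) hm
  obtain ⟨a1, a2, a3⟩ := (mem_tri a).mp ha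
  obtain ⟨p1, p2, p3⟩ := (mem_tri p).mp hp
  rcases hb with (hb | hb) | hb
  · have h0 := coord_zero_of_mem (z := Δ.x3) hb
    exact Or.inl (Or.inl (mem_edge₁₂ hmT (zero_of_zero hm (zero_of_nonneg hbo h0 a1 p1) h0)))
  · have h0 := coord_zero_of_mem (z := Δ.x1) hb
    exact Or.inl (Or.inr (mem_edge₂₃ hmT (zero_of_zero hm (zero_of_nonneg hbo h0 a2 p2) h0)))
  · have h0 := coord_zero_of_mem (z := Δ.x2) hb
    exact Or.inr (mem_edge₃₁ hmT (zero_of_zero hm (zero_of_nonneg hbo h0 a3 p3) h0))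

theorem mem_chord {a b p : Pt} (hab : a ≠ b) (ha : a ∈ Δ.bdry) (hb : b ∈ Δ.bdry)
    (ho : ∀ q ∈ openSegment ℝ a b, q ∉ Δ.bdry) (hp : p ∈ Δ.tri) (h0 : cr a b p = 0) :
    p ∈ segment ℝ a b := by
  obtain ⟨t, rfl⟩ := exists_lineMap_of_cr hab h0
  have hm : AffineMap.lineMap a b (1 / 2 : ℝ) ∈ openSegment ℝ a b := by
    rw [openSegment_eq_image_lineMap]; exact ⟨_, by norm_num, rfl⟩
  rw [segment_eq_image_lineMap]
  refine ⟨t, ⟨?_, ?_⟩, rfl⟩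
  · by_contra! ht
    refine ho _ hm ?_
    rw [openSegment_symm] at hm
    refine openSegment_subset_bdry (bdry_subset_tri hb) hp ha ?_ hm
    have h1 : 1 - t ≠ 0 := by linarith
    refine ⟨-t / (1 - t), 1 / (1 - t), div_pos (by linarith) (by linarith),
      div_pos one_pos (by linarith), by field_simp; ring, ?_⟩
    rw [AffineMap.lineMap_apply_module']
    have : (-t / (1 - t)) = 1 / (1 - t) * (-t) := by ring
    have h2 : (1 / (1 - t)) * (1 - t) = 1 := by field_simp
    calc _ = (1 / (1 - t) * (1 - t)) • a := by rw [this]; module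
      _ = a := by rw [h2, one_smul]
  · by_contra! ht
    refine ho _ hm ?_
    refine openSegment_subset_bdry (bdry_subset_tri ha) hp hb ?_ hm
    refine ⟨1 - 1 / t, 1 / t, ?_, by positivity, by ring, ?_⟩
    · rw [sub_pos, div_lt_one (by linarith)]; exact ht
    · rw [AffineMap.lineMap_apply_module']
      have h2 : 1 / t * t = 1 := by field_simp
      calc _ = (1 / t * t) • (b - a) + a := by module
        _ = b := by rw [h2]; module

variable (Δ) in
/-- The functional `φ` cuts out the segment `s` in the triangle. -/
structure IsRep (s : Set Pt) (φ : Pt →ᵃ[ℝ] ℝ) : Prop where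
  form : ∃ (a b : Pt) (c : ℝ), a ≠ b ∧ c ≠ 0 ∧ a ∈ Δ.tri ∧ b ∈ Δ.tri ∧ s = segment ℝ a b ∧
    φ = c • cr a b
  mem : ∀ p ∈ Δ.tri, φ p = 0 → p ∈ s

theorem IsRep.zero {s : Set Pt} {φ : Pt →ᵃ[ℝ] ℝ} (h : Δ.IsRep s φ) {p : Pt} (hp : p ∈ s) :
    φ p = 0 := by
  obtain ⟨a, b, c, -, -, -, -, rfl, rfl⟩ := h.form
  simp [cr_of_mem_segment hp]

theorem IsRep.subset_tri {s : Set Pt} {φ : Pt →ᵃ[ℝ] ℝ} (h : Δ.IsRep s φ) : s ⊆ Δ.tri := by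
  obtain ⟨a, b, c, -, -, ha, hb, rfl, -⟩ := h.form
  exact convex_tri.segment_subset ha hb

theorem ne_of_cr_ne_zero {x y z : Pt} (h : cr x y z ≠ 0) : x ≠ y := by
  rintro rfl
  simp [cr_apply] at h

theorem isRep₁₂ : Δ.IsRep (segment ℝ Δ.x1 Δ.x2) (coord Δ.x1 Δ.x2 Δ.x3) :=
  ⟨⟨_, _, _, ne_of_cr_ne_zero cr_ne_zero, inv_ne_zero cr_ne_zero, x1_mem_tri, x2_mem_tri, rfl,
    rfl⟩, fun _ => mem_edge₁₂⟩

theorem isRep₂₃ : Δ.IsRep (segment ℝ Δ.x2 Δ.x3) (coord Δ.x2 Δ.x3 Δ.x1) := by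
  have h : cr Δ.x2 Δ.x3 Δ.x1 ≠ 0 := by rw [cr_rotate]; exact cr_ne_zero
  exact ⟨⟨_, _, _, ne_of_cr_ne_zero h, inv_ne_zero h, x2_mem_tri, x3_mem_tri, rfl, rfl⟩,
    fun _ => mem_edge₂₃⟩

theorem isRep₃₁ : Δ.IsRep (segment ℝ Δ.x3 Δ.x1) (coord Δ.x3 Δ.x1 Δ.x2) := by
  have h : cr Δ.x3 Δ.x1 Δ.x2 ≠ 0 := by rw [cr_rotate, cr_rotate]; exact cr_ne_zero
  exact ⟨⟨_, _, _, ne_of_cr_ne_zero h, inv_ne_zero h, x3_mem_tri, x1_mem_tri, rfl, rfl⟩,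
    fun _ => mem_edge₃₁⟩

theorem edge_ne {x y z : Pt} (h : cr x y z ≠ 0) : segment ℝ x y ≠ segment ℝ y z := fun he => by
  have h1 := coord_self h
  rw [coord_zero_of_mem (he ▸ right_mem_segment ℝ y z)] at h1
  exact zero_ne_one h1

variable (Δ) in
/-- The functional `φ` cuts out `s`, and is normalised if `s` is an edge. -/
def IsNormRep (s : Set Pt) (φ : Pt →ᵃ[ℝ] ℝ) : Prop := Δ.IsRep s φ ∧
  (s = segment ℝ Δ.x1 Δ.x2 → φ = coord Δ.x1 Δ.x2 Δ.x3) ∧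
  (s = segment ℝ Δ.x2 Δ.x3 → φ = coord Δ.x2 Δ.x3 Δ.x1) ∧
  (s = segment ℝ Δ.x3 Δ.x1 → φ = coord Δ.x3 Δ.x1 Δ.x2)

theorem exists_isNormRep {s : Set Pt} (hs : s ∈ Δ.Sbar ∪ Δ.B) : ∃ φ, Δ.IsNormRep s φ := by
  have h1 : cr Δ.x1 Δ.x2 Δ.x3 ≠ 0 := cr_ne_zero
  have h2 : cr Δ.x2 Δ.x3 Δ.x1 ≠ 0 := by rwa [cr_rotate]
  have h3 : cr Δ.x3 Δ.x1 Δ.x2 ≠ 0 := by rwa [cr_rotate]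
  by_cases he : s ∈ triEdges Δ.x1 Δ.x2 Δ.x3
  · rcases he with rfl | rfl | rfl
    · exact ⟨_, isRep₁₂, fun _ => rfl, fun h => absurd h (edge_ne h1),
        fun h => absurd h.symm (edge_ne h3)⟩
    · exact ⟨_, isRep₂₃, fun h => absurd h.symm (edge_ne h1), fun _ => rfl,
        fun h => absurd h (edge_ne h2)⟩
    · exact ⟨_, isRep₃₁, fun h => absurd h (edge_ne h3), fun h => absurd h.symm (edge_ne h2),
        fun _ => rfl⟩
  · have hs' : s ∈ Δ.S ∪ Δ.B := by
      rcases hs with (h | h) | h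
      · exact Or.inl h
      · exact absurd h he
      · exact Or.inr h
    obtain ⟨a, b, hab, rfl, ha, hb, ho⟩ := Δ.seg_wf s hs'
    refine ⟨(1 : ℝ) • cr a b, ⟨⟨a, b, 1, hab, one_ne_zero, bdry_subset_tri ha, bdry_subset_tri hb,
      rfl, rfl⟩, fun p hp h0 => mem_chord hab ha hb ho hp (by simpa using h0)⟩, ?_, ?_, ?_⟩
    · exact fun h => absurd (by rw [h]; simp [triEdges]) he
    · exact fun h => absurd (by rw [h]; simp [triEdges]) he
    · exact fun h => absurd (by rw [h]; simp [triEdges]) he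

variable (Δ) in
/-- A functional cutting out the segment `s`. -/
def fn (s : Set Pt) : Pt →ᵃ[ℝ] ℝ := Classical.epsilon (Δ.IsNormRep s)

theorem isNormRep_fn {s : Set Pt} (hs : s ∈ Δ.Sbar ∪ Δ.B) : Δ.IsNormRep s (Δ.fn s) :=
  Classical.epsilon_spec (exists_isNormRep hs)

theorem isRep_fn {s : Set Pt} (hs : s ∈ Δ.Sbar) : Δ.IsRep s (Δ.fn s) :=
  (isNormRep_fn (Or.inl hs)).1

theorem isRep_block {b : Set Pt} (hb : b ∈ Δ.B) : Δ.IsRep b (Δ.fn b) :=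
  (isNormRep_fn (Or.inr hb)).1

theorem edge_mem_Sbar {e : Set Pt} (he : e ∈ triEdges Δ.x1 Δ.x2 Δ.x3) : e ∈ Δ.Sbar := Or.inr he

theorem edge₁₂_mem : segment ℝ Δ.x1 Δ.x2 ∈ triEdges Δ.x1 Δ.x2 Δ.x3 := by simp [triEdges]

theorem edge₂₃_mem : segment ℝ Δ.x2 Δ.x3 ∈ triEdges Δ.x1 Δ.x2 Δ.x3 := by simp [triEdges]

theorem edge₃₁_mem : segment ℝ Δ.x3 Δ.x1 ∈ triEdges Δ.x1 Δ.x2 Δ.x3 := by simp [triEdges]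

theorem fn_edge₁₂ : Δ.fn (segment ℝ Δ.x1 Δ.x2) = coord Δ.x1 Δ.x2 Δ.x3 :=
  (isNormRep_fn (Or.inl (edge_mem_Sbar edge₁₂_mem))).2.1 rfl

theorem fn_edge₂₃ : Δ.fn (segment ℝ Δ.x2 Δ.x3) = coord Δ.x2 Δ.x3 Δ.x1 :=
  (isNormRep_fn (Or.inl (edge_mem_Sbar edge₂₃_mem))).2.2.1 rfl

theorem fn_edge₃₁ : Δ.fn (segment ℝ Δ.x3 Δ.x1) = coord Δ.x3 Δ.x1 Δ.x2 :=
  (isNormRep_fn (Or.inl (edge_mem_Sbar edge₃₁_mem))).2.2.2 rfl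

theorem mem_tri_iff (p : Pt) :
    p ∈ Δ.tri ↔ ∀ e ∈ triEdges Δ.x1 Δ.x2 Δ.x3, 0 ≤ Δ.fn e p := by
  simp [triEdges, mem_tri, fn_edge₁₂, fn_edge₂₃, fn_edge₃₁]

theorem exists_edge_linear_neg {d : Pt} (hd : d ≠ 0) :
    ∃ e ∈ triEdges Δ.x1 Δ.x2 Δ.x3, (Δ.fn e).linear d < 0 := by
  by_contra! h
  have e1 := h _ edge₁₂_mem
  have e2 := h _ edge₂₃_mem
  have e3 := h _ edge₃₁_mem
  rw [fn_edge₁₂] at e1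
  rw [fn_edge₂₃] at e2
  rw [fn_edge₃₁] at e3
  have hv : ∀ φ : Pt →ᵃ[ℝ] ℝ, φ (Δ.x1 + d) = φ.linear d + φ Δ.x1 := fun φ => by
    rw [add_comm]; exact φ.map_vadd _ _
  have s1 := coord_sum (cr_ne_zero (Δ := Δ)) (Δ.x1 + d)
  have s0 := coord_sum (cr_ne_zero (Δ := Δ)) Δ.x1
  have c1 := eq_coord_combo (cr_ne_zero (Δ := Δ)) (Δ.x1 + d)
  have c0 := eq_coord_combo (cr_ne_zero (Δ := Δ)) Δ.x1
  simp only [hv] at s1 c1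
  have z1 : (coord Δ.x1 Δ.x2 Δ.x3).linear d = 0 := by linarith
  have z2 : (coord Δ.x2 Δ.x3 Δ.x1).linear d = 0 := by linarith
  have z3 : (coord Δ.x3 Δ.x1 Δ.x2).linear d = 0 := by linarith
  rw [z1, z2, z3, zero_add, zero_add, zero_add, ← c0] at c1
  exact hd (by simpa using c1)

theorem IsRep.eq_of_zero {s s' : Set Pt} {φ φ' : Pt →ᵃ[ℝ] ℝ} (h : Δ.IsRep s φ)
    (h' : Δ.IsRep s' φ') {x y : Pt} (hxy : x ≠ y) (hx : φ x = 0) (hy : φ y = 0) (hx' : φ' x = 0)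
    (hy' : φ' y = 0) : s = s' := by
  have key : ∀ {s s' : Set Pt} {φ φ' : Pt →ᵃ[ℝ] ℝ}, Δ.IsRep s φ → Δ.IsRep s' φ' → φ x = 0 →
      φ y = 0 → φ' x = 0 → φ' y = 0 → s ⊆ s' := by
    intro s s' φ φ' h h' hx hy hx' hy' z hz
    have hzT := h.subset_tri hz
    have hz0 := h.zero hz
    obtain ⟨a, b, c, hab, hc, -, -, rfl, rfl⟩ := h.form
    have hcr : ∀ w, (c • cr a b) w = 0 → cr a b w = 0 := fun w hw =>
      (mul_eq_zero.mp (show c * cr a b w = 0 from hw)).resolve_left hc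
    obtain ⟨t, rfl⟩ := exists_lineMap_of_cr_of_cr hab (hcr _ hx) (hcr _ hy) (hcr _ hz0) hxy
    refine h'.mem _ hzT ?_
    rw [AffineMap.apply_lineMap, hx', hy', AffineMap.lineMap_same_apply]
  exact subset_antisymm (key h h' hx hy hx' hy') (key h' h hx' hy' hx hy)

theorem finite_Sbar : Δ.Sbar.Finite := Δ.finS.union (by simp [triEdges])

theorem block_notMem_Sbar {b : Set Pt} (hb : b ∈ Δ.B) : b ∉ Δ.Sbar := by
  intro hs
  have hrep := isRep_fn hs
  obtain ⟨x, y, -, hxy, -, -, -, hbs, -⟩ := hrep.form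
  have hinf : b.Infinite := by
    rw [hbs, segment_eq_image_lineMap]
    exact (Icc_infinite zero_lt_one).image (AffineMap.lineMap_injective ℝ hxy).injOn
  refine hinf ?_
  have hsub : b ⊆ ⋃ s ∈ {s ∈ Δ.Sbar | s ≠ b}, b ∩ s := by
    intro p hp
    obtain ⟨s', ⟨h1, h2, h3⟩, -⟩ := Δ.second_segment b hs b hb p hp hp
    exact mem_biUnion (show s' ∈ {s ∈ Δ.Sbar | s ≠ b} from ⟨h1, h2⟩) ⟨hp, h3⟩
  refine Finite.subset (Finite.biUnion (finite_Sbar.subset (sep_subset _ _)) ?_) hsub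
  rintro s ⟨hsS, hsb⟩
  refine Subsingleton.finite fun p hp q hq => ?_
  by_contra hpq
  have hrep' := isRep_fn hsS
  exact hsb (hrep'.eq_of_zero hrep hpq (hrep'.zero hp.2) (hrep'.zero hq.2) (hrep.zero hp.1)
    (hrep.zero hq.1))

variable (Δ) in
/-- The line system of the arrangement. -/
def lines : LineSystem Δ.Sbar Δ.B where
  T := Δ.tri
  f i := Δ.fn i
  h k := Δ.fn k
  edge i := i.1 ∈ triEdges Δ.x1 Δ.x2 Δ.x3
  mem_T p := by
    rw [mem_tri_iff]
    exact ⟨fun h e he => h e.1 he, fun h e he => h ⟨e, edge_mem_Sbar he⟩ he⟩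
  escape d hd := by
    obtain ⟨e, he, h⟩ := exists_edge_linear_neg (Δ := Δ) hd
    exact ⟨⟨e, edge_mem_Sbar he⟩, he, h⟩
  coll i x y z hx hy hz hxy := by
    obtain ⟨a, b, c, hab, hc, -, -, -, hφ⟩ := (isRep_fn i.2).form
    have hcr : ∀ w, Δ.fn i w = 0 → cr a b w = 0 := fun w hw => by
      rw [hφ] at hw
      exact (mul_eq_zero.mp (show c * cr a b w = 0 from hw)).resolve_left hc
    exact exists_lineMap_of_cr_of_cr hab (hcr _ hx) (hcr _ hy) (hcr _ hz) hxy
  two i := by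
    have hrep := isRep_fn i.2
    obtain ⟨a, b, -, hab, -, ha, hb, hs, -⟩ := hrep.form
    exact ⟨a, ha, b, hb, hab, hrep.zero (hs ▸ left_mem_segment ℝ a b),
      hrep.zero (hs ▸ right_mem_segment ℝ a b)⟩
  inj i j x y _ _ hxy h1 h2 h3 h4 :=
    Subtype.ext ((isRep_fn i.2).eq_of_zero (isRep_fn j.2) hxy h1 h2 h3 h4)
  no_three i j k p hij hik hjk hp h1 h2 h3 :=
    Δ.no_three_concurrent i i.2 j j.2 k k.2 (Subtype.coe_ne_coe.mpr hij)
      (Subtype.coe_ne_coe.mpr hik) (Subtype.coe_ne_coe.mpr hjk)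
      ⟨p, (isRep_fn i.2).mem p hp h1, (isRep_fn j.2).mem p hp h2, (isRep_fn k.2).mem p hp h3⟩
  block i j p hij he hp h1 h2 := by
    obtain ⟨b, ⟨hb, hpb⟩, -⟩ := Δ.block_exists i i.2 j j.2 (Subtype.coe_ne_coe.mpr hij) he p
      ((isRep_fn i.2).mem p hp h1) ((isRep_fn j.2).mem p hp h2)
    exact ⟨⟨b, hb⟩, (isRep_block hb).zero hpb⟩
  block_sep i k p q _ _ hpq h1 h2 h3 h4 := by
    have := (isRep_fn i.2).eq_of_zero (isRep_block k.2) hpq h1 h2 h3 h4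
    exact block_notMem_Sbar k.2 (this ▸ i.2)
  second i k p hp h1 h2 := by
    obtain ⟨s, ⟨hs, hsi, hps⟩, -⟩ := Δ.second_segment i i.2 k k.2 p
      ((isRep_fn i.2).mem p hp h1) ((isRep_block k.2).mem p hp h2)
    exact ⟨⟨s, hs⟩, fun h => hsi (congrArg Subtype.val h), (isRep_fn hs).zero hps⟩

instance : Finite Δ.Sbar := finite_Sbar.to_subtype

theorem mem_of_fn_zero {i : Δ.Sbar} {p : Pt} (hp : p ∈ Δ.tri) (h : Δ.lines.f i p = 0) :
    p ∈ (i : Set Pt) := (isRep_fn i.2).mem p hp h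

theorem fn_zero_of_mem {i : Δ.Sbar} {p : Pt} (h : p ∈ (i : Set Pt)) : Δ.lines.f i p = 0 :=
  (isRep_fn i.2).zero h

theorem isMinRegion_cell {p : Pt} (hp : p ∈ Δ.tri) (hp0 : ∀ i, Δ.lines.f i p ≠ 0) :
    Δ.IsMinRegion (Δ.lines.cell p) := by
  have hU : Δ.tri \ ⋃₀ Δ.Sbar = {x ∈ Δ.lines.T | ∀ i, Δ.lines.f i x ≠ 0} := by
    ext x
    constructor
    · rintro ⟨hx, hn⟩
      exact ⟨hx, fun i h => hn ⟨i, i.2, mem_of_fn_zero hx h⟩⟩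
    · rintro ⟨hx, hn⟩
      refine ⟨hx, ?_⟩
      rintro ⟨s, hs, hxs⟩
      exact hn ⟨s, hs⟩ (fn_zero_of_mem hxs)
  refine ⟨p, ?_, ?_⟩
  · rw [hU]; exact ⟨hp, hp0⟩
  · rw [hU]; exact (LineSystem.closure_component hp hp0).symm

theorem containsEdgeOf_cell {p u v : Pt} {i : Δ.Sbar} (hp : p ∈ Δ.tri)
    (hp0 : ∀ i, Δ.lines.f i p ≠ 0) (S : Δ.lines.IsSide p i u v) :
    Δ.ContainsEdgeOf i (Δ.lines.cell p) := by
  refine ⟨u, v, S.ne, fun z hz => ?_⟩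
  have h := S.segment_subset_frontier hp0 z hz
  exact ⟨mem_of_fn_zero (LineSystem.mem_T_of_cell hp hp0
    ((LineSystem.isClosed_cell p).frontier_subset h.2)) h.1, h.2⟩

theorem isRegionVertex_cell {p u v w : Pt} {i j : Δ.Sbar} (hp : p ∈ Δ.tri)
    (hp0 : ∀ i, Δ.lines.f i p ≠ 0) (hij : i ≠ j) (S : Δ.lines.IsSide p i u v)
    (S' : Δ.lines.IsSide p j v w) : Δ.IsRegionVertex (Δ.lines.cell p) v := by
  have hv := LineSystem.mem_T_of_cell hp hp0 S.right
  exact ⟨S.right, i, i.2, j, j.2, Subtype.coe_ne_coe.mpr hij, mem_of_fn_zero hv S.zero_right,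
    mem_of_fn_zero hv S'.zero_left, containsEdgeOf_cell hp hp0 S, containsEdgeOf_cell hp hp0 S'⟩

theorem consec_cell {p u v w y : Pt} {i j k : Δ.Sbar} (hp : p ∈ Δ.tri)
    (hp0 : ∀ i, Δ.lines.f i p ≠ 0) (hij : i ≠ j) (hjk : j ≠ k) (S : Δ.lines.IsSide p i u v)
    (S' : Δ.lines.IsSide p j v w) (S'' : Δ.lines.IsSide p k w y) :
    Δ.Consec (Δ.lines.cell p) v w :=
  ⟨S'.ne, isRegionVertex_cell hp hp0 hij S S', isRegionVertex_cell hp hp0 hjk S' S'',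
    fun z hz => (S'.segment_subset_frontier hp0 z hz).2⟩

theorem zero_of_mem_affineSpan {φ : Pt →ᵃ[ℝ] ℝ} {u v q : Pt} (hu : φ u = 0) (hv : φ v = 0)
    (hq : q ∈ affineSpan ℝ ({u, v} : Set Pt)) : φ q = 0 := by
  obtain ⟨t, rfl⟩ := mem_affineSpan_pair_iff_exists_lineMap_eq.mp hq
  rw [AffineMap.apply_lineMap, hu, hv, AffineMap.lineMap_same_apply]

theorem cellStrong (hΔ : Δ.Strong) : Δ.lines.CellStrong := by
  intro p k i₀₁ i₁₂ i₂₃ i₃₄ i₄₅ i₅₆ v₀ v₁ v₂ v₃ v₄ v₅ v₆ g hp hp0 s01 s12 s23 s34 s45 s56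
    n1 n2 n3 n4 n5 hpw k3 kp hg fg kg
  have hk := isRep_block k.2
  have hgb : g ∈ (k : Set Pt) := hk.mem g hg kg
  obtain ⟨t, ht⟩ := Δ.lines.coll i₁₂ v₁ v₂ g s12.zero_left s12.zero_right fg s12.ne
  obtain ⟨q, hqb, hq1, hq2⟩ := hΔ _ (isMinRegion_cell hp hp0) v₁ v₂ v₃ v₄ v₅ hpw
    (consec_cell hp hp0 n1 n2 s01 s12 s23) (consec_cell hp hp0 n2 n3 s12 s23 s34)
    (consec_cell hp hp0 n3 n4 s23 s34 s45) (consec_cell hp hp0 n4 n5 s34 s45 s56) k k.2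
    (hk.mem v₃ (LineSystem.mem_T_of_cell hp hp0 s23.right) k3)
    ⟨p, hk.mem p hp kp, LineSystem.mem_interior_cell hp0⟩
    ⟨g, hg, ht ▸ AffineMap.lineMap_mem_affineSpan_pair t v₁ v₂, hgb⟩
  have f1 := zero_of_mem_affineSpan s12.zero_left s12.zero_right hq1
  have f2 := zero_of_mem_affineSpan s45.zero_left s45.zero_right hq2
  have hgq : g = q := by
    by_contra h
    exact Δ.lines.block_sep i₁₂ k g q hg (hk.subset_tri hqb) h fg f1 kg (hk.zero hqb)
  rwa [hgq]

theorem strongStep (hΔ : Δ.Strong) : Δ.lines.StrongStep :=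
  LineSystem.strongStep_of_cellStrong (cellStrong hΔ)

theorem minimalSeg_of {A : Δ.Sbar} {x y : Pt}
    (h : ∀ (s : Δ.Sbar) p, p ∈ openSegment ℝ x y → Δ.lines.f s p = 0 → s = A) :
    Δ.MinimalSeg x y := by
  rintro p hp ⟨s₁, h₁, s₂, h₂, hne, hp₁, hp₂⟩
  have e₁ := h ⟨s₁, h₁⟩ p hp (fn_zero_of_mem hp₁)
  have e₂ := h ⟨s₂, h₂⟩ p hp (fn_zero_of_mem hp₂)
  exact hne (congrArg Subtype.val (e₁.trans e₂.symm))

theorem mem_openSegment_of_sbtw {v w x : Pt} (h : Sbtw ℝ v w x) : w ∈ openSegment ℝ x v := by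
  rw [openSegment_symm, openSegment_eq_image_lineMap]
  exact (sbtw_iff_mem_image_Ioo_and_ne.mp h).1

theorem notMem_edges_of {s : Set Pt} (hs : s ∈ Δ.S) : s ∉ triEdges Δ.x1 Δ.x2 Δ.x3 := by
  intro he
  obtain ⟨a, b, hab, rfl, -, -, ho⟩ := Δ.seg_wf s (Or.inl hs)
  have hm : midpoint ℝ a b ∈ openSegment ℝ a b := by
    rw [openSegment_eq_image_lineMap]
    exact ⟨_, ⟨by norm_num, by norm_num⟩, rfl⟩
  refine ho _ hm ?_
  have hm' := openSegment_subset_segment ℝ a b hm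
  rcases he with he | he | he <;> rw [he] at hm'
  · exact Or.inl (Or.inl hm')
  · exact Or.inl (Or.inr hm')
  · exact Or.inr hm'

theorem isCrossing {a₁ b₁ a₂ b₂ c : Pt}
    (hord₁ : Sbtw ℝ Δ.x1 b₁ a₁ ∧ Sbtw ℝ b₁ a₁ Δ.x2)
    (hord₂ : Sbtw ℝ Δ.x3 a₂ b₂ ∧ Sbtw ℝ a₂ b₂ Δ.x2)
    (ha₁ : a₁ ∈ segment ℝ Δ.x1 Δ.x2) (hb₁ : b₁ ∈ segment ℝ Δ.x1 Δ.x2)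
    (ha₂ : a₂ ∈ segment ℝ Δ.x2 Δ.x3) (hb₂ : b₂ ∈ segment ℝ Δ.x2 Δ.x3)
    (hA : segment ℝ a₁ a₂ ∈ Δ.S) (hB : segment ℝ b₁ b₂ ∈ Δ.S)
    (hc : c ∈ segment ℝ a₁ a₂ ∩ segment ℝ b₁ b₂) :
    Δ.lines.IsCrossing ⟨_, edge_mem_Sbar edge₁₂_mem⟩ ⟨_, edge_mem_Sbar edge₂₃_mem⟩
      ⟨_, Or.inl hA⟩ ⟨_, Or.inl hB⟩ Δ.x2 a₁ b₁ a₂ b₂ c := by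
  have hEE : segment ℝ Δ.x1 Δ.x2 ≠ segment ℝ Δ.x2 Δ.x3 := edge_ne cr_ne_zero
  have nA := notMem_edges_of hA
  have nB := notMem_edges_of hB
  have AE : segment ℝ a₁ a₂ ≠ segment ℝ Δ.x1 Δ.x2 := fun h => nA (h ▸ edge₁₂_mem)
  have AE' : segment ℝ a₁ a₂ ≠ segment ℝ Δ.x2 Δ.x3 := fun h => nA (h ▸ edge₂₃_mem)
  have BE : segment ℝ b₁ b₂ ≠ segment ℝ Δ.x1 Δ.x2 := fun h => nB (h ▸ edge₁₂_mem)
  have BE' : segment ℝ b₁ b₂ ≠ segment ℝ Δ.x2 Δ.x3 := fun h => nB (h ▸ edge₂₃_mem)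
  have hAB : segment ℝ a₁ a₂ ≠ segment ℝ b₁ b₂ := fun h => by
    have rA := isRep_fn (Δ := Δ) (Or.inl hA)
    have hb : b₁ ∈ segment ℝ a₁ a₂ := h ▸ left_mem_segment ℝ b₁ b₂
    have rE := isRep_fn (Δ := Δ) (edge_mem_Sbar edge₁₂_mem)
    exact AE (rA.eq_of_zero rE hord₁.1.ne_right (rA.zero hb) (rA.zero (left_mem_segment ℝ a₁ a₂))
      (rE.zero hb₁) (rE.zero ha₁))
  have hnE : c ∉ segment ℝ Δ.x1 Δ.x2 := fun h => Δ.no_three_concurrent _ (Or.inl hA) _ (Or.inl hB)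
    _ (Or.inr edge₁₂_mem) hAB AE BE ⟨c, hc.1, hc.2, h⟩
  have hnE' : c ∉ segment ℝ Δ.x2 Δ.x3 := fun h => Δ.no_three_concurrent _ (Or.inl hA) _
    (Or.inl hB) _ (Or.inr edge₂₃_mem) hAB AE' BE' ⟨c, hc.1, hc.2, h⟩
  have hT₁ := convex_tri.segment_subset (x1_mem_tri (Δ := Δ)) x2_mem_tri
  have hT₂ := convex_tri.segment_subset (x2_mem_tri (Δ := Δ)) x3_mem_tri
  exact {
    hx := x2_mem_tri
    hb := hT₁ hb₁
    ha₂ := hT₂ ha₂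
    Ex := fn_zero_of_mem (right_mem_segment ℝ _ _)
    Eb := fn_zero_of_mem hb₁
    Ex' := fn_zero_of_mem (left_mem_segment ℝ _ _)
    Ea₂ := fn_zero_of_mem ha₂
    Aa := fn_zero_of_mem (left_mem_segment ℝ _ _)
    Aa₂ := fn_zero_of_mem (right_mem_segment ℝ _ _)
    Bb := fn_zero_of_mem (left_mem_segment ℝ _ _)
    Bb₂ := fn_zero_of_mem (right_mem_segment ℝ _ _)
    hE := fun h => hEE (congrArg Subtype.val h)
    eA := nA
    eB := nB
    xb := hord₁.2.left_ne_right.symm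
    xa₂ := hord₂.2.left_ne_right.symm
    ao := mem_openSegment_of_sbtw hord₁.2
    bo := mem_openSegment_of_sbtw hord₂.2
    cA := mem_openSegment_of_ne_left_right (by rintro rfl; exact hnE ha₁)
      (by rintro rfl; exact hnE' ha₂) hc.1
    cB := mem_openSegment_of_ne_left_right (by rintro rfl; exact hnE hb₁)
      (by rintro rfl; exact hnE' hb₂) hc.2 }

end TBA

/-- Lemma 14: under the hypotheses of Lemma 12, the subsegments `a₁c` and `b₂c` are
minimal, and the blocking segment through `x₂` passes through `c`. -/
theorem TBA.S12_minimal_and_blocking (Δ : TBA) (hstrong : Δ.Strong)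
    (a₁ b₁ a₂ b₂ c : Pt)
    (hord₁ : Sbtw ℝ Δ.x1 b₁ a₁ ∧ Sbtw ℝ b₁ a₁ Δ.x2)
    (hord₂ : Sbtw ℝ Δ.x3 a₂ b₂ ∧ Sbtw ℝ a₂ b₂ Δ.x2)
    (ha₁ : a₁ ∈ segment ℝ Δ.x1 Δ.x2) (hb₁ : b₁ ∈ segment ℝ Δ.x1 Δ.x2)
    (ha₂ : a₂ ∈ segment ℝ Δ.x2 Δ.x3) (hb₂ : b₂ ∈ segment ℝ Δ.x2 Δ.x3)
    (hA : segment ℝ a₁ a₂ ∈ Δ.S) (hB : segment ℝ b₁ b₂ ∈ Δ.S)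
    (hc : c ∈ segment ℝ a₁ a₂ ∩ segment ℝ b₁ b₂) :
    Δ.MinimalSeg a₁ c ∧ Δ.MinimalSeg b₂ c ∧ ∃ b ∈ Δ.B, Δ.x2 ∈ b ∧ c ∈ b := by
  have X := isCrossing hord₁ hord₂ ha₁ hb₁ ha₂ hb₂ hA hB hc
  have hS := strongStep hstrong
  obtain ⟨b, ⟨hb, hcb⟩, -⟩ := Δ.block_exists _ (Or.inl hA) _ (Or.inl hB)
    (Subtype.coe_ne_coe.mpr X.ne_AB) (fun h => notMem_edges_of hA h.1) c hc.1 hc.2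
  refine ⟨minimalSeg_of fun s p => X.eq_of_mem_openSegment hS,
    minimalSeg_of fun s p => X.symm.eq_of_mem_openSegment hS, b, hb, ?_, hcb⟩
  exact (isRep_block hb).mem _ x2_mem_tri
    (X.block_zero hS (k := ⟨b, hb⟩) ((isRep_block hb).zero hcb))
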